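/- arXiv:2401.05816 — 3 statements merged into one kernel-verified Lean document; each statement's English description precedes it below -/
import Mathlib

section
/- Fix an integer e ≥ 2 and κ = (κ₁, κ₂) ∈ (ℤ/eℤ)². A bipartition λ has wt(λ) = 0 if and only if λ is a bicore and γ_x(λ) − γ_y(λ) ≤ 1 for all x, y ∈ ℤ/eℤ (computed with respect to any bicharge for κ). -/
namespace Wt3

/-- `f : ℕ → ℕ` (0-indexed: `f r` is the `(r+1)`-th part `λ_{r+1}`) is a partition if it is
weakly decreasing with finitely many nonzero terms. -/
def IsPartition (f : ℕ → ℕ) : Prop :=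
  (∀ r, f (r + 1) ≤ f r) ∧ ∃ N, ∀ r, N ≤ r → f r = 0

/-- A bipartition: an ordered pair of partitions, given as `lam : Fin 2 → ℕ → ℕ`. -/
def IsBipartition (lam : Fin 2 → ℕ → ℕ) : Prop := ∀ a, IsPartition (lam a)

/-- Nodes `(r, c, a)` with 0-indexed row `r`, column `c`, and component `a : Fin 2`. -/
abbrev Node := ℕ × ℕ × Fin 2

/-- The Young diagram of a bipartition: `(r,c,a)` is a node iff `c < λ⁽ᵃ⁾_r` (0-indexed,
corresponding to `c+1 ≤ λ⁽ᵃ⁾_{r+1}` in 1-indexed terms). -/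
def Diagram (lam : Fin 2 → ℕ → ℕ) : Set Node := {x | x.2.1 < lam x.2.2 x.1}

/-- A node of `[λ]` is removable if deleting it leaves the Young diagram of a bipartition. -/
def IsRemovable (lam : Fin 2 → ℕ → ℕ) (x : Node) : Prop :=
  x ∈ Diagram lam ∧ ∃ mu, IsBipartition mu ∧ Diagram mu = Diagram lam \ {x}

/-- A node not in `[λ]` is addable if adding it gives the Young diagram of a bipartition. -/
def IsAddable (lam : Fin 2 → ℕ → ℕ) (x : Node) : Prop :=
  x ∉ Diagram lam ∧ ∃ mu, IsBipartition mu ∧ Diagram mu = Diagram lam ∪ {x}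

/-- The residue `c − r + κ_a ∈ ℤ/eℤ` of a node `(r,c,a)` (0-indexing leaves this unchanged). -/
def res (e : ℕ) (κ : Fin 2 → ZMod e) (x : Node) : ZMod e :=
  (x.2.1 : ZMod e) - (x.1 : ZMod e) + κ x.2.2

/-- `c_i(λ)`: the number of `i`-nodes of `λ`. -/
noncomputable def cnt (e : ℕ) (κ : Fin 2 → ZMod e) (lam : Fin 2 → ℕ → ℕ) (i : ZMod e) : ℕ :=
  Set.ncard {x : Node | x ∈ Diagram lam ∧ res e κ x = i}

/-- The number of removable `i`-nodes of `λ`. -/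
noncomputable def remCount (e : ℕ) (κ : Fin 2 → ZMod e) (lam : Fin 2 → ℕ → ℕ) (i : ZMod e) : ℕ :=
  Set.ncard {x : Node | IsRemovable lam x ∧ res e κ x = i}

/-- The number of addable `i`-nodes of `λ`. -/
noncomputable def addCount (e : ℕ) (κ : Fin 2 → ZMod e) (lam : Fin 2 → ℕ → ℕ) (i : ZMod e) : ℕ :=
  Set.ncard {x : Node | IsAddable lam x ∧ res e κ x = i}

/-- `δ_i(λ)`: number of removable `i`-nodes minus number of addable `i`-nodes. -/
noncomputable def delta (e : ℕ) (κ : Fin 2 → ZMod e) (lam : Fin 2 → ℕ → ℕ) (i : ZMod e) : ℤ :=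
  (remCount e κ lam i : ℤ) - (addCount e κ lam i : ℤ)

/-- The weight `wt(λ) = c_{κ₁}(λ) + c_{κ₂}(λ) − ½ Σ_{i ∈ ℤ/eℤ} (c_i(λ) − c_{i+1}(λ))²`. -/
noncomputable def wt (e : ℕ) (κ : Fin 2 → ZMod e) (lam : Fin 2 → ℕ → ℕ) : ℚ :=
  (cnt e κ lam (κ 0) : ℚ) + (cnt e κ lam (κ 1) : ℚ) -
    (1 / 2) * ∑ j ∈ Finset.range e,
      ((cnt e κ lam (j : ZMod e) : ℚ) - (cnt e κ lam ((j : ZMod e) + 1) : ℚ)) ^ 2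

/-- The rim of `λ`: nodes `(r,c,a) ∈ [λ]` with `(r+1,c+1,a) ∉ [λ]`. -/
def Rim (lam : Fin 2 → ℕ → ℕ) : Set Node :=
  {x | x ∈ Diagram lam ∧ (x.1 + 1, x.2.1 + 1, x.2.2) ∉ Diagram lam}

/-- One step along a strip: `y` is one step to the right of, or one step above, `x`
(in the same component). -/
def Step (x y : Node) : Prop :=
  y.2.2 = x.2.2 ∧ ((y.1 = x.1 ∧ y.2.1 = x.2.1 + 1) ∨ (x.1 = y.1 + 1 ∧ y.2.1 = x.2.1))

/-- A rim hook of `λ`: a nonempty subset of the rim, contained in a single component,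
forming a connected strip, whose removal leaves the Young diagram of a bipartition. -/
def IsRimHook (lam : Fin 2 → ℕ → ℕ) (H : Finset Node) : Prop :=
  H.Nonempty ∧ ↑H ⊆ Rim lam ∧ (∀ x ∈ H, ∀ y ∈ H, x.2.2 = y.2.2) ∧
    (∃ l : List Node, l.Chain' Step ∧ ∀ x : Node, x ∈ l ↔ x ∈ H) ∧
    ∃ mu, IsBipartition mu ∧ Diagram mu = Diagram lam \ ↑H

/-- A bicore: a bipartition with no rim `e`-hooks. -/
def IsBicore (e : ℕ) (lam : Fin 2 → ℕ → ℕ) : Prop :=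
  ¬ ∃ H : Finset Node, IsRimHook lam H ∧ H.card = e

/-- The beta-set `{λ_r + k − r : 1 ≤ r ≤ k}` of a partition with charge `k` (0-indexed form). -/
def betaSet (f : ℕ → ℕ) (k : ℕ) : Finset ℕ :=
  (Finset.range k).image fun r => f r + (k - (r + 1))

/-- The number of nonzero parts of a partition. -/
noncomputable def len (f : ℕ → ℕ) : ℕ := Set.ncard {r : ℕ | f r ≠ 0}

/-- `(k₁,k₂)` is a bicharge for `κ` relative to `λ`. -/
def IsBicharge (e : ℕ) (κ : Fin 2 → ZMod e) (lam : Fin 2 → ℕ → ℕ) (k₁ k₂ : ℕ) : Prop :=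
  (k₁ : ZMod e) = κ 0 ∧ (k₂ : ZMod e) = κ 1 ∧ len (lam 0) ≤ k₁ ∧ len (lam 1) ≤ k₂

/-- `γ_x(λ)`: beads of residue `x` in the first beta-set minus those in the second. -/
def gamma (e : ℕ) (lam : Fin 2 → ℕ → ℕ) (k₁ k₂ : ℕ) (x : ZMod e) : ℤ :=
  (((betaSet (lam 0) k₁).filter fun b : ℕ => (b : ZMod e) = x).card : ℤ) -
    (((betaSet (lam 1) k₂).filter fun b : ℕ => (b : ZMod e) = x).card : ℤ)

/-- `x` is above (higher than) `y`. -/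
def Above (x y : Node) : Prop := x.2.2 < y.2.2 ∨ (x.2.2 = y.2.2 ∧ x.1 < y.1)

/-- A normal `i`-node: a removable `i`-node `x` such that for every addable `i`-node `y`
below `x`, the removable `i`-nodes strictly between `x` and `y` outnumber the addable ones
(equivalently, the `−` sign of `x` survives in the reduced `i`-signature). -/
def IsNormal (e : ℕ) (κ : Fin 2 → ZMod e) (lam : Fin 2 → ℕ → ℕ) (i : ZMod e) (x : Node) :
    Prop :=
  IsRemovable lam x ∧ res e κ x = i ∧
    ∀ y : Node, IsAddable lam y → res e κ y = i → Above x y →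
      Set.ncard {z : Node | IsAddable lam z ∧ res e κ z = i ∧ Above x z ∧ Above z y} <
        Set.ncard {z : Node | IsRemovable lam z ∧ res e κ z = i ∧ Above x z ∧ Above z y}

/-- The good `i`-node: the highest normal `i`-node. -/
def IsGood (e : ℕ) (κ : Fin 2 → ZMod e) (lam : Fin 2 → ℕ → ℕ) (i : ZMod e) (x : Node) :
    Prop :=
  IsNormal e κ lam i x ∧ ∀ y, IsNormal e κ lam i y → y = x ∨ Above x y

/-- An antinormal `i`-node: a removable `i`-node `x` such that for every addable `i`-node `y`
above `x`, the removable `i`-nodes strictly between `y` and `x` outnumber the addable ones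
(equivalently, the `−` sign of `x` survives in the antireduced `i`-signature). -/
def IsAntinormal (e : ℕ) (κ : Fin 2 → ZMod e) (lam : Fin 2 → ℕ → ℕ) (i : ZMod e) (x : Node) :
    Prop :=
  IsRemovable lam x ∧ res e κ x = i ∧
    ∀ y : Node, IsAddable lam y → res e κ y = i → Above y x →
      Set.ncard {z : Node | IsAddable lam z ∧ res e κ z = i ∧ Above y z ∧ Above z x} <
        Set.ncard {z : Node | IsRemovable lam z ∧ res e κ z = i ∧ Above y z ∧ Above z x}

/-- The antigood `i`-node: the lowest antinormal `i`-node. -/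
def IsAntigood (e : ℕ) (κ : Fin 2 → ZMod e) (lam : Fin 2 → ℕ → ℕ) (i : ZMod e) (x : Node) :
    Prop :=
  IsAntinormal e κ lam i x ∧ ∀ y, IsAntinormal e κ lam i y → y = x ∨ Above y x

/-- `μ →ᵢ λ`: `μ` is obtained from `λ` by removing the good `i`-node. -/
def RemGoodAt (e : ℕ) (κ : Fin 2 → ZMod e) (i : ZMod e) (mu lam : Fin 2 → ℕ → ℕ) : Prop :=
  ∃ x, IsGood e κ lam i x ∧ Diagram mu = Diagram lam \ {x}

/-- `μ ⇒ᵢ λ`: `μ` is obtained from `λ` by removing the antigood `i`-node. -/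
def RemAntigoodAt (e : ℕ) (κ : Fin 2 → ZMod e) (i : ZMod e) (mu lam : Fin 2 → ℕ → ℕ) : Prop :=
  ∃ x, IsAntigood e κ lam i x ∧ Diagram mu = Diagram lam \ {x}

/-- `μ → λ`: `μ` is obtained from the bipartition `λ` by removing a good node. -/
def RemGood (e : ℕ) (κ : Fin 2 → ZMod e) (mu lam : Fin 2 → ℕ → ℕ) : Prop :=
  IsBipartition mu ∧ IsBipartition lam ∧ ∃ i, RemGoodAt e κ i mu lam

/-- A bipartition is restricted if it lies in the class of the empty bipartition under the
equivalence relation generated by `→`. -/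
def IsRestricted (e : ℕ) (κ : Fin 2 → ZMod e) (lam : Fin 2 → ℕ → ℕ) : Prop :=
  Relation.EqvGen (RemGood e κ) lam (fun _ _ => 0)

/-- A partition is `e`-restricted if `λ_r − λ_{r+1} < e` for all `r`. -/
def IsERestricted (e : ℕ) (f : ℕ → ℕ) : Prop := ∀ r, f r < f (r + 1) + e

/-- The conjugate partition: `λ′_r = #{c : λ_c ≥ r}` (0-indexed form). -/
noncomputable def conjP (f : ℕ → ℕ) : ℕ → ℕ := fun r => Set.ncard {c : ℕ | r + 1 ≤ f c}

/-- The conjugate bipartition `λ′ = ((λ⁽²⁾)′ | (λ⁽¹⁾)′)`. -/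
noncomputable def conjB (lam : Fin 2 → ℕ → ℕ) : Fin 2 → ℕ → ℕ := fun a => conjP (lam (1 - a))

/-- `|λ|` for a partition. -/
noncomputable def psize (f : ℕ → ℕ) : ℕ := Set.ncard {p : ℕ × ℕ | p.2 < f p.1}

/-- `|λ|` for a bipartition. -/
noncomputable def bsize (lam : Fin 2 → ℕ → ℕ) : ℕ := psize (lam 0) + psize (lam 1)

/-- `λ_1 + ⋯ + λ_r`. -/
def psum (f : ℕ → ℕ) (r : ℕ) : ℕ := ∑ j ∈ Finset.range r, f j

/-- The dominance order on bipartitions: `λ ⊵ μ`. -/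
def Dominates (lam mu : Fin 2 → ℕ → ℕ) : Prop :=
  ∀ r : ℕ, psum (mu 0) r ≤ psum (lam 0) r ∧
    psize (mu 0) + psum (mu 1) r ≤ psize (lam 0) + psum (lam 1) r

/-! Single-partition versions (for statement 11). -/

abbrev Node1 := ℕ × ℕ

def Diagram1 (f : ℕ → ℕ) : Set Node1 := {x | x.2 < f x.1}

def IsRemovable1 (f : ℕ → ℕ) (x : Node1) : Prop :=
  x ∈ Diagram1 f ∧ ∃ g, IsPartition g ∧ Diagram1 g = Diagram1 f \ {x}

def IsAddable1 (f : ℕ → ℕ) (x : Node1) : Prop :=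
  x ∉ Diagram1 f ∧ ∃ g, IsPartition g ∧ Diagram1 g = Diagram1 f ∪ {x}

def res1 (e : ℕ) (k : ZMod e) (x : Node1) : ZMod e := (x.2 : ZMod e) - (x.1 : ZMod e) + k

def Rim1 (f : ℕ → ℕ) : Set Node1 := {x | x ∈ Diagram1 f ∧ (x.1 + 1, x.2 + 1) ∉ Diagram1 f}

def Step1 (x y : Node1) : Prop :=
  (y.1 = x.1 ∧ y.2 = x.2 + 1) ∨ (x.1 = y.1 + 1 ∧ y.2 = x.2)

def IsRimHook1 (f : ℕ → ℕ) (H : Finset Node1) : Prop :=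
  H.Nonempty ∧ ↑H ⊆ Rim1 f ∧
    (∃ l : List Node1, l.Chain' Step1 ∧ ∀ x : Node1, x ∈ l ↔ x ∈ H) ∧
    ∃ g, IsPartition g ∧ Diagram1 g = Diagram1 f \ ↑H

/-- An `e`-core: a partition with no rim `e`-hooks. -/
def IsECore (e : ℕ) (f : ℕ → ℕ) : Prop := ¬ ∃ H : Finset Node1, IsRimHook1 f H ∧ H.card = e

/-- The number of elements of `B` of residue `x` modulo `e`. -/
def beads (e : ℕ) (B : Finset ℕ) (x : ZMod e) : ℤ :=
  ((B.filter fun b : ℕ => (b : ZMod e) = x).card : ℤ)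

/-- Twice the `e`-weight of a finite set of beads. -/
def abacusWeight (e : ℕ) [NeZero e] (B : Finset ℕ) : ℤ :=
  ∑ x : ZMod e, (2 * ∑ b ∈ B.filter (fun b : ℕ => (b : ZMod e) = x), ((b / e : ℕ) : ℤ) -
    beads e B x * (beads e B x - 1))

/-- Every bead is pushed up as far as possible on its runner of the `e`-abacus. -/
def IsFlush (e : ℕ) (B : Finset ℕ) : Prop := ∀ b ∈ B, e ≤ b → b - e ∈ B

theorem card_mul_pred_le_two_mul_sum (S : Finset ℕ) :
    (S.card : ℤ) * (S.card - 1) ≤ 2 * ∑ s ∈ S, (s : ℤ) ∧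
      (2 * ∑ s ∈ S, (s : ℤ) = (S.card : ℤ) * (S.card - 1) ↔ ∀ s ∈ S, ∀ t < s, t ∈ S) := by
  induction S using Finset.induction_on_max with
  | empty => simp
  | insert a S ha ih =>
    have haS : a ∉ S := fun h => lt_irrefl _ (ha a h)
    have hsub : S ⊆ Finset.range a := fun x hx => Finset.mem_range.2 (ha x hx)
    have hcard : S.card ≤ a := by simpa using Finset.card_le_card hsub
    have hcard' : (S.card : ℤ) ≤ a := by exact_mod_cast hcard
    obtain ⟨h1, h2⟩ := ih
    rw [Finset.sum_insert haS, Finset.card_insert_of_notMem haS]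
    push_cast
    refine ⟨by nlinarith, ?_, ?_⟩
    · intro h s hs t hts
      have hac : a = S.card := by
        have : (a : ℤ) = S.card := by nlinarith
        exact_mod_cast this
      have hS : S = Finset.range a := Finset.eq_of_subset_of_card_le hsub (by simp [← hac])
      rw [Finset.mem_insert, hS, Finset.mem_range] at hs ⊢
      omega
    · intro h
      have hS : ∀ t < a, t ∈ S := fun t ht =>
        (Finset.mem_insert.1 (h a (Finset.mem_insert_self _ _) t ht)).resolve_left ht.ne
      have hac : a ≤ S.card := by
        have : Finset.range a ⊆ S := fun t ht => hS t (Finset.mem_range.1 ht)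
        simpa using Finset.card_le_card this
      have hac' : (a : ℤ) = S.card := by exact_mod_cast le_antisymm hac hcard
      have := h2.2 fun s hs t hts => hS t (hts.trans (ha s hs))
      rw [mul_add, this, hac']
      ring

theorem injOn_div_runner (e : ℕ) (B : Finset ℕ) (x : ZMod e) :
    Set.InjOn (fun b => b / e) (B.filter fun b : ℕ => (b : ZMod e) = x : Finset ℕ) := by
  intro b hb c hc h
  simp only [Finset.coe_filter, Set.mem_ofPred_eq] at hb hc h
  have := (ZMod.natCast_eq_natCast_iff' b c e).1 (hb.2.trans hc.2.symm)
  rw [← Nat.div_add_mod b e, ← Nat.div_add_mod c e, h, this]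

theorem IsFlush.sub_mul_mem {e : ℕ} {B : Finset ℕ} (h : IsFlush e B) {b : ℕ} (hb : b ∈ B) (j : ℕ)
    (hj : e * j ≤ b) : b - e * j ∈ B := by
  induction j with
  | zero => simpa
  | succ j ih =>
    rw [Nat.mul_succ] at hj ⊢
    rw [← Nat.sub_sub]
    exact h _ (ih (by omega)) (by omega)

theorem isFlush_iff_runners (e : ℕ) (he : 0 < e) (B : Finset ℕ) :
    IsFlush e B ↔ ∀ x : ZMod e,
      ∀ s ∈ (B.filter fun b : ℕ => (b : ZMod e) = x).image (fun b => b / e),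
        ∀ t < s, t ∈ (B.filter fun b : ℕ => (b : ZMod e) = x).image (fun b => b / e) := by
  constructor
  · intro h x s hs t hts
    simp only [Finset.mem_image, Finset.mem_filter] at hs ⊢
    obtain ⟨b, ⟨hb, hx⟩, rfl⟩ := hs
    have hle : e * (b / e - t) ≤ b :=
      (Nat.mul_le_mul_left e (Nat.sub_le _ _)).trans (Nat.mul_div_le b e)
    refine ⟨b - e * (b / e - t), ⟨h.sub_mul_mem hb _ hle, ?_⟩, ?_⟩
    · rw [Nat.cast_sub hle]; simp [hx]
    · rw [Nat.sub_mul_div]; omega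
  · intro h b hb heb
    have h1 : b / e - 1 < b / e := by
      have := Nat.div_pos heb he
      omega
    have := h (b : ZMod e) (b / e) (Finset.mem_image.2 ⟨b, by simp [hb], rfl⟩) _ h1
    simp only [Finset.mem_image, Finset.mem_filter] at this
    obtain ⟨c, ⟨hc, hcx⟩, hcd⟩ := this
    have hmod := (ZMod.natCast_eq_natCast_iff' c b e).1 hcx
    have hb' := Nat.div_add_mod b e
    have hc' := Nat.div_add_mod c e
    rw [hcd, Nat.mul_sub, hmod, Nat.mul_one] at hc'
    have : e * 1 ≤ e * (b / e) := Nat.mul_le_mul_left e (by omega)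
    have : b - e = c := by omega
    rwa [this]

theorem abacusWeight_nonneg_and_eq_zero_iff (e : ℕ) [NeZero e] (B : Finset ℕ) :
    0 ≤ abacusWeight e B ∧ (abacusWeight e B = 0 ↔ IsFlush e B) := by
  have key : ∀ x : ZMod e, _ := fun x => card_mul_pred_le_two_mul_sum
    ((B.filter fun b : ℕ => (b : ZMod e) = x).image (fun b => b / e))
  simp only [Finset.sum_image (injOn_div_runner e B _),
    Finset.card_image_of_injOn (injOn_div_runner e B _)] at key
  have hnn : ∀ x ∈ Finset.univ, 0 ≤
      (2 * ∑ b ∈ B.filter (fun b : ℕ => (b : ZMod e) = x), ((b / e : ℕ) : ℤ) -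
        beads e B x * (beads e B x - 1)) := fun x _ => sub_nonneg.2 (key x).1
  refine ⟨Finset.sum_nonneg hnn, ?_⟩
  rw [isFlush_iff_runners e (NeZero.pos e), abacusWeight, Finset.sum_eq_zero_iff_of_nonneg hnn]
  refine ⟨fun h x => (key x).2.1 (sub_eq_zero.1 (h x (Finset.mem_univ _))), fun h x _ =>
    sub_eq_zero.2 ((key x).2.2 (h x))⟩

theorem isFlush_range (e k : ℕ) : IsFlush e (Finset.range k) := by
  intro b hb _
  rw [Finset.mem_range] at hb ⊢
  omega

theorem two_mul_sum_div (e : ℕ) [NeZero e] (B : Finset ℕ) :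
    2 * ∑ b ∈ B, ((b / e : ℕ) : ℤ) =
      abacusWeight e B + ∑ x : ZMod e, beads e B x * (beads e B x - 1) := by
  rw [abacusWeight, Finset.sum_sub_distrib, sub_add_cancel, ← Finset.mul_sum,
    Finset.sum_fiberwise]

theorem beads_range_succ (e k : ℕ) (x : ZMod e) :
    beads e (Finset.range (k + 1)) x =
      beads e (Finset.range k) x + if (k : ZMod e) = x then 1 else 0 := by
  rw [beads, beads, Finset.range_add_one, Finset.filter_insert]
  split_ifs with h
  · rw [Finset.card_insert_of_notMem (by simp)]; push_cast; rfl
  · simp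

theorem beads_eq_sum (e : ℕ) (B : Finset ℕ) (x : ZMod e) :
    beads e B x = ∑ b ∈ B, if (b : ZMod e) = x then 1 else 0 := by
  simp [beads]

theorem beads_range_succ' (e k : ℕ) (x : ZMod e) :
    beads e (Finset.range (k + 1)) (x + 1) =
      beads e (Finset.range k) x + if (0 : ZMod e) = x + 1 then 1 else 0 := by
  rw [beads_eq_sum, Finset.sum_range_succ', beads_eq_sum]
  simp

theorem beads_range_succ_zero (e k : ℕ) :
    beads e (Finset.range (k + 1)) 0 = ((k / e : ℕ) : ℤ) + 1 := by
  induction k with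
  | zero => rw [beads_range_succ]; simp [beads]
  | succ k ih =>
    rw [beads_range_succ, ih, Nat.succ_div]
    simp only [ZMod.natCast_eq_zero_iff]
    split_ifs <;> push_cast <;> ring

theorem sum_range_natCast_eq (e : ℕ) [NeZero e] (k : ℕ) (d : ZMod e → ℤ) :
    ∑ j ∈ Finset.range k, d j = ∑ x, d x * beads e (Finset.range k) x := by
  rw [← Finset.sum_fiberwise (Finset.range k) (fun j : ℕ => (j : ZMod e))]
  refine Finset.sum_congr rfl fun x _ => ?_
  rw [Finset.sum_congr rfl (g := fun _ => d x), Finset.sum_const, beads, nsmul_eq_mul, mul_comm]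
  intro j hj
  rw [(Finset.mem_filter.1 hj).2]

theorem sum_beads (e : ℕ) [NeZero e] (B : Finset ℕ) : ∑ x, beads e B x = B.card := by
  simp only [beads]
  exact_mod_cast (Finset.card_eq_sum_card_fiberwise (fun _ _ => Finset.mem_univ _)).symm

theorem beads_range_sub_bounds (e : ℕ) [NeZero e] (k₁ k₂ : ℕ) :
    ∃ q : ℤ, ∀ x, beads e (Finset.range k₂) x - beads e (Finset.range k₁) x = q ∨
      beads e (Finset.range k₂) x - beads e (Finset.range k₁) x = q + 1 := by
  have h : ∀ k x, beads e (Finset.range k) x =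
      ((k / e : ℕ) : ℤ) + if x.val < k % e then 1 else 0 := by
    intro k x
    have h1 := Nat.count_modEq_card k (NeZero.pos e) x.val
    rw [Nat.count_eq_card_filter_range, Nat.mod_eq_of_lt (ZMod.val_lt x)] at h1
    have h2 : ∀ b : ℕ, (b : ZMod e) = x ↔ b ≡ x.val [MOD e] := fun b => by
      rw [← ZMod.natCast_eq_natCast_iff, ZMod.natCast_zmod_val]
    simp only [beads, h2, h1]
    push_cast
    rfl
  rcases le_total (k₁ % e) (k₂ % e) with hle | hle
  · refine ⟨((k₂ / e : ℕ) : ℤ) - ((k₁ / e : ℕ) : ℤ), fun x => ?_⟩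
    rw [h, h]
    split_ifs <;> omega
  · refine ⟨((k₂ / e : ℕ) : ℤ) - ((k₁ / e : ℕ) : ℤ) - 1, fun x => ?_⟩
    rw [h, h]
    split_ifs <;> omega

theorem IsPartition.antitone {f : ℕ → ℕ} (hf : IsPartition f) : Antitone f :=
  antitone_nat_of_succ_le hf.1

theorem IsPartition.eq_zero_of_len_le {f : ℕ → ℕ} (hf : IsPartition f) {k r : ℕ}
    (hk : len f ≤ k) (hr : k ≤ r) : f r = 0 := by
  by_contra h
  obtain ⟨N, hN⟩ := hf.2
  have hfin : {r : ℕ | f r ≠ 0}.Finite :=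
    (Set.finite_lt_nat N).subset fun s hs => not_le.1 fun h' => hs (hN s h')
  have hsub : (↑(Finset.range (r + 1)) : Set ℕ) ⊆ {r : ℕ | f r ≠ 0} := by
    intro s hs
    have hs' : s ≤ r := by simpa [Nat.lt_succ_iff] using hs
    have := hf.antitone hs'
    simp only [Set.mem_ofPred_eq]
    omega
  have := Set.ncard_le_ncard hsub hfin
  rw [Set.ncard_coe_finset, Finset.card_range] at this
  rw [len] at hk
  omega

theorem IsPartition.strictAnti {f : ℕ → ℕ} (hf : IsPartition f) :
    StrictAnti fun r => (f r : ℤ) - r :=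
  strictAnti_nat_of_succ_lt fun r => by
    have := hf.1 r
    push_cast
    omega

/-- The content of a node. -/
def content (x : Node) : ℤ := (x.2.1 : ℤ) - x.1

theorem content_of_step {x y : Node} (h : Step x y) : content y = content x + 1 := by
  simp only [Step, content] at *
  omega

theorem content_getElem_of_chain {l : List Node} (hl : l.IsChain Step) (i : ℕ) (hi : i < l.length) :
    content l[i] = content (l[0]'(by omega)) + i := by
  induction i with
  | zero => simp
  | succ i ih =>
    have h := List.isChain_iff_getElem.1 hl i hi
    rw [content_of_step h, ih (by omega)]
    push_cast
    ring

theorem exists_forall_sub_ne_of_isRimHook {lam : Fin 2 → ℕ → ℕ} (hlam : IsBipartition lam)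
    {H : Finset Node} (hH : IsRimHook lam H) :
    ∃ a r, ∀ s, (lam a s : ℤ) - s ≠ (lam a r : ℤ) - r - H.card := by
  obtain ⟨⟨x, hx⟩, hrim, hcomp, ⟨l, hl, hlH⟩, mu, hmu, hdiag⟩ := hH
  have hnodup : l.Nodup := by
    rw [List.nodup_iff_injective_getElem]
    intro i j hij
    have h1 := content_getElem_of_chain hl i i.2
    have h2 := content_getElem_of_chain hl j j.2
    have h3 : l[(i : ℕ)] = l[(j : ℕ)] := hij
    rw [h3] at h1
    ext
    omega
  have hlen : l.length = H.card := by
    rw [← List.toFinset_card_of_nodup hnodup]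
    congr 1
    ext y
    simp [hlH]
  have hpos : 0 < l.length := hlen ▸ Finset.card_pos.2 ⟨x, hx⟩
  have hrange : ∀ y ∈ H, content l[0] ≤ content y ∧ content y < content l[0] + H.card := by
    intro y hy
    obtain ⟨i, hi, rfl⟩ := List.getElem_of_mem ((hlH y).2 hy)
    rw [content_getElem_of_chain hl i hi]
    omega
  have hmem : ∀ y : Node, y ∈ Diagram mu ↔ y ∈ Diagram lam ∧ y ∉ H := by
    intro y
    rw [hdiag]
    simp
  have hfirst := (hlH _).1 (List.getElem_mem hpos)
  have hlast := (hlH _).1 (List.getElem_mem (show l.length - 1 < l.length by omega))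
  have hclast := content_getElem_of_chain hl (l.length - 1) (by omega)
  have hsame := hcomp _ hfirst _ hlast
  generalize hu : l[0] = u at *
  generalize hv : l[l.length - 1] = v at *
  obtain ⟨r₀, c₀, a⟩ := u
  obtain ⟨r₁, c₁, a'⟩ := v
  obtain rfl : a = a' := hsame
  have h0 : c₀ < lam a r₀ := (hrim hfirst).1
  have h1 : c₁ < lam a r₁ := (hrim hlast).1
  have h0' : ¬ c₀ < mu a r₀ := fun h => ((hmem (r₀, c₀, a)).1 h).2 hfirst
  have h1' : ¬ c₁ < mu a r₁ := fun h => ((hmem (r₁, c₁, a)).1 h).2 hlast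
  have hright : ¬ c₁ + 1 < lam a r₁ := by
    intro h
    have hH : (r₁, c₁ + 1, a) ∈ H := by
      by_contra hn
      have : c₁ + 1 < mu a r₁ := (hmem (r₁, c₁ + 1, a)).2 ⟨h, hn⟩
      omega
    have := (hrange _ hH).2
    simp only [content] at this hclast
    omega
  have hbelow : ¬ c₀ < lam a (r₀ + 1) := by
    intro h
    have hH : (r₀ + 1, c₀, a) ∈ H := by
      by_contra hn
      have : c₀ < mu a (r₀ + 1) := (hmem (r₀ + 1, c₀, a)).2 ⟨h, hn⟩
      have := (hmu a).1 r₀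
      omega
    have := (hrange _ hH).1
    simp only [content] at this
    omega
  refine ⟨a, r₁, fun s hs => ?_⟩
  simp only [content] at hclast
  have hanti := (hlam a).strictAnti
  rcases le_or_gt s r₀ with h | h
  · have : (lam a r₀ : ℤ) - r₀ ≤ lam a s - s := hanti.antitone h
    omega
  · have : (lam a s : ℤ) - s ≤ lam a (r₀ + 1) - (r₀ + 1 : ℕ) :=
      hanti.antitone (show r₀ + 1 ≤ s from h)
    push_cast at this
    omega

theorem exists_row {f : ℕ → ℕ} (hf : IsPartition f) {j : ℤ} (hj : j < f 0) :
    ∃ t : ℕ, (f (t + 1) : ℤ) - (t + 1) ≤ j ∧ j < (f t : ℤ) - t := by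
  have hex : ∃ t : ℕ, (f (t + 1) : ℤ) - (t + 1) ≤ j := by
    refine ⟨(f 0 - j).toNat, ?_⟩
    have := hf.antitone (Nat.zero_le ((f 0 - j).toNat + 1))
    omega
  classical
  refine ⟨Nat.find hex, Nat.find_spec hex, ?_⟩
  rcases h : Nat.find hex with _ | t
  · simpa using hj
  · have := Nat.find_min hex (m := t) (by omega)
    push_cast at *
    omega

theorem row_unique {f : ℕ → ℕ} (hf : IsPartition f) {j : ℤ} {t t' : ℕ}
    (h1 : (f (t + 1) : ℤ) - (t + 1) ≤ j) (h2 : j < (f t : ℤ) - t)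
    (h1' : (f (t' + 1) : ℤ) - (t' + 1) ≤ j) (h2' : j < (f t' : ℤ) - t') : t = t' := by
  have hanti := hf.strictAnti.antitone
  rcases lt_trichotomy t t' with h | h | h
  · have := hanti (show t + 1 ≤ t' from h)
    simp only at this
    push_cast at this
    omega
  · exact h
  · have := hanti (show t' + 1 ≤ t from h)
    simp only at this
    push_cast at this
    omega

theorem exists_isRimHook {lam : Fin 2 → ℕ → ℕ} (hlam : IsBipartition lam) {e : ℕ} (he : 0 < e)
    {a : Fin 2} {r : ℕ} (hr : ∀ s, (lam a s : ℤ) - s ≠ (lam a r : ℤ) - r - e) :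
    ∃ H : Finset Node, IsRimHook lam H ∧ H.card = e := by
  obtain ⟨f, hfdef⟩ : ∃ f, f = lam a := ⟨_, rfl⟩
  have hf : IsPartition f := hfdef ▸ hlam a
  simp only [← hfdef] at hr
  have hanti := hf.strictAnti
  have hanti' : ∀ {s t : ℕ}, s ≤ t → (f t : ℤ) - t ≤ (f s : ℤ) - s := fun h => hanti.antitone h
  set p : ℤ := (f r : ℤ) - r - e with hp
  -- an empty row reaching `p` would make `p` a shifted part
  have hpz : ∀ s : ℕ, f s = 0 → -(s : ℤ) < p := by
    intro s hs
    by_contra hlt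
    have h1 := hf.antitone (show s ≤ (-p).toNat by omega)
    have h2 := hr (-p).toNat
    omega
  have hrow : ∀ i : ℕ, i < e → ∃ t : ℕ, (f (t + 1) : ℤ) - (t + 1) ≤ p + i ∧ p + i < (f t : ℤ) - t := by
    intro i hi
    refine exists_row hf ?_
    have := hanti' (Nat.zero_le r)
    push_cast at this
    omega
  choose! t ht using hrow
  have hcol : ∀ i < e, 0 ≤ p + i + t i := by
    intro i hi
    have := (ht i hi).1
    by_contra hlt
    have := hpz (t i + 1) (by omega)
    push_cast at this
    omega
  let node : ℕ → Node := fun i => (t i, (p + i + t i).toNat, a)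
  have hcont : ∀ i < e, content (node i) = p + i := by
    intro i hi
    have := hcol i hi
    simp only [content, node]
    omega
  have hH : ∀ x : Node, x ∈ (Finset.range e).image node ↔
      x.2.2 = a ∧ p ≤ content x ∧ content x < p + e ∧ x.2.1 < f x.1 ∧ f (x.1 + 1) ≤ x.2.1 + 1 := by
    rintro ⟨s, c, a'⟩
    simp only [Finset.mem_image, Finset.mem_range]
    constructor
    · rintro ⟨i, hi, hx⟩
      have h1 := hcont i hi
      have h2 := ht i hi
      have h3 := hcol i hi
      simp only [node, Prod.mk.injEq] at hx
      obtain ⟨rfl, rfl, rfl⟩ := hx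
      simp only [content, node] at *
      refine ⟨trivial, ?_, ?_, ?_, ?_⟩ <;> omega
    · rintro ⟨rfl, h1, h2, h3, h4⟩
      simp only [content] at h1 h2
      change c < f s at h3
      change f (s + 1) ≤ c + 1 at h4
      refine ⟨((c : ℤ) - s - p).toNat, by omega, ?_⟩
      have h5 := ht ((c : ℤ) - s - p).toNat (by omega)
      have : t ((c : ℤ) - s - p).toNat = s :=
        row_unique hf h5.1 h5.2 (by omega) (by omega)
      simp only [node, Prod.mk.injEq, this]
      refine ⟨trivial, by omega, trivial⟩
  refine ⟨(Finset.range e).image node, ⟨?_, ?_, ?_, ?_, ?_⟩, ?_⟩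
  · exact ⟨node 0, Finset.mem_image_of_mem _ (Finset.mem_range.2 he)⟩
  · rintro ⟨s, c, a'⟩ hx
    obtain ⟨rfl, -, -, h3, h4⟩ := (hH _).1 (Finset.mem_coe.1 hx)
    simp only [Rim, Diagram, Set.mem_ofPred_eq, ← hfdef]
    exact ⟨h3, by simp only at h4; omega⟩
  · intro x hx y hy
    rw [((hH x).1 hx).1, ((hH y).1 hy).1]
  · refine ⟨(List.range e).map node, ?_, by simp⟩
    show List.IsChain Step _
    rw [List.isChain_map, List.isChain_range]
    intro i hi
    have h1 := ht i (by omega)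
    have h2 := ht (i + 1) (by omega)
    have h3 := hcol i (by omega)
    have h4 := hcol (i + 1) (by omega)
    refine ⟨rfl, ?_⟩
    simp only [node]
    push_cast at *
    by_cases h : p + i + 1 < (f (t i) : ℤ) - t i
    · left
      have := row_unique hf h2.1 h2.2 (t' := t i) (by omega) (by omega)
      rw [this]
      omega
    · right
      have htpos : t i ≠ 0 := by
        intro h0
        have := hanti' (Nat.zero_le r)
        rw [h0] at h h1
        push_cast at this h
        omega
      obtain ⟨u, hu⟩ := Nat.exists_eq_succ_of_ne_zero htpos
      have h5 := hf.1 u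
      have h6 : f (u + 1) = f (t i) := by rw [hu]
      have := row_unique hf h2.1 h2.2 (t' := u) (by omega)
        (by omega)
      rw [this] at h4 ⊢
      omega
  · let g : ℕ → ℕ := fun s => if s < r ∨ (f s : ℤ) - s ≤ p then f s else
      (max (p + s) (f (s + 1) - 1)).toNat
    have hg : ∀ s, (s < r ∨ (f s : ℤ) - s ≤ p) ∧ g s = f s ∨
        (r ≤ s ∧ p < (f s : ℤ) - s) ∧ (g s : ℤ) = max (p + s) (f (s + 1) - 1) := by
      intro s
      by_cases h : s < r ∨ (f s : ℤ) - s ≤ p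
      · exact Or.inl ⟨h, if_pos h⟩
      · refine Or.inr ⟨by omega, ?_⟩
        have := hpz (s + 1)
        simp only [g, h, if_false]
        rw [Int.toNat_of_nonneg]
        push_cast at this
        omega
    have hgpart : IsPartition g := by
      obtain ⟨N, hN⟩ := hf.2
      have hgf : ∀ s, g s ≤ f s := by
        intro s
        have := hg s
        have := hf.1 s
        omega
      refine ⟨fun s => ?_, N, fun s hs => by have := hgf s; have := hN s hs; omega⟩
      have h1 := hg s
      have h2 := hg (s + 1)
      have h3 := hf.1 s
      have h4 := hf.1 (s + 1)
      have h5 := hgf s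
      have h6 := hgf (s + 1)
      have h7 := hr (s + 1)
      push_cast at *
      omega
    refine ⟨Function.update lam a g, ?_, ?_⟩
    · intro b
      by_cases h : b = a
      · subst h; simpa using hgpart
      · simpa [h] using hlam b
    · ext ⟨s, c, b⟩
      rw [Set.mem_sdiff, Finset.mem_coe, hH]
      by_cases h : b = a
      · subst h
        simp only [Diagram, Set.mem_ofPred_eq, Function.update_self, content, ← hfdef, true_and]
        have h1 := hg s
        have h2 := hr s
        have h3 := hf.1 s
        rcases lt_or_ge s r with hsr | hsr
        · have := hanti' (show s + 1 ≤ r from hsr)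
          push_cast at this
          omega
        · have := hanti' hsr
          omega
      · simp [Diagram, h]
  · rw [Finset.card_image_of_injOn, Finset.card_range]
    intro i hi j hj hij
    have h1 := hcont i (by simpa using hi)
    have h2 := hcont j (by simpa using hj)
    rw [hij] at h1
    omega

theorem isBicore_iff {lam : Fin 2 → ℕ → ℕ} (hlam : IsBipartition lam) {e : ℕ} (he : 0 < e) :
    IsBicore e lam ↔ ∀ a r, ∃ s, (lam a s : ℤ) - s = (lam a r : ℤ) - r - e := by
  constructor
  · intro h a r
    by_contra! hr
    exact h (exists_isRimHook hlam he hr)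
  · rintro h ⟨H, hH, rfl⟩
    obtain ⟨a, r, hr⟩ := exists_forall_sub_ne_of_isRimHook hlam hH
    obtain ⟨s, hs⟩ := h a r
    exact hr s hs

theorem isFlush_betaSet_iff {f : ℕ → ℕ} (hf : IsPartition f) {k : ℕ} (hk : len f ≤ k) (e : ℕ) :
    IsFlush e (betaSet f k) ↔ ∀ r, ∃ s, (f s : ℤ) - s = (f r : ℤ) - r - e := by
  have hz : ∀ r, k ≤ r → f r = 0 := fun r hr => hf.eq_zero_of_len_le hk hr
  simp only [IsFlush, betaSet, Finset.mem_image, Finset.mem_range]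
  constructor
  · intro h r
    rcases le_or_gt k r with hr | hr
    · refine ⟨r + e, ?_⟩
      rw [hz r hr, hz (r + e) (by omega)]
      push_cast
      omega
    · by_cases hb : e ≤ f r + (k - (r + 1))
      · obtain ⟨s, hs, hse⟩ := h _ ⟨r, hr, rfl⟩ hb
        exact ⟨s, by omega⟩
      · refine ⟨r + e - f r, ?_⟩
        rw [hz (r + e - f r) (by omega)]
        omega
  · rintro h _ ⟨r, hr, rfl⟩ hb
    obtain ⟨s, hs⟩ := h r
    have hsk : s < k := by
      by_contra hsk
      have := hz s (by omega)
      omega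
    exact ⟨s, hsk, by omega⟩

theorem card_row (e : ℕ) (i : ZMod e) (n r k : ℕ) (hr : r < k) :
    (((Finset.range n).filter fun c : ℕ => (c : ZMod e) - r + k = i).card : ℤ) =
      beads e (Finset.range (n + (k - (r + 1)) + 1)) i -
        beads e (Finset.range (k - (r + 1) + 1)) i := by
  induction n with
  | zero => simp
  | succ n ih =>
    have hcast : ((n + (k - (r + 1)) + 1 : ℕ) : ZMod e) = (n : ZMod e) - r + k := by
      rw [add_assoc, show k - (r + 1) + 1 = k - r by omega, Nat.cast_add, Nat.cast_sub hr.le]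
      ring
    rw [Finset.range_add_one, Finset.filter_insert,
      show n + 1 + (k - (r + 1)) + 1 = n + (k - (r + 1)) + 1 + 1 by omega, beads_range_succ, hcast]
    split_ifs with h
    · rw [Finset.card_insert_of_notMem (by simp)]
      push_cast
      rw [ih]
      ring
    · rw [ih]
      ring

/-- Node counts of one component, read off its beta-set. -/
def residueCount (e : ℕ) (f : ℕ → ℕ) (k : ℕ) (i : ZMod e) : ℤ :=
  ∑ b ∈ betaSet f k, beads e (Finset.range (b + 1)) i -
    ∑ b ∈ Finset.range k, beads e (Finset.range (b + 1)) i

theorem injOn_beta {f : ℕ → ℕ} (hf : IsPartition f) (k : ℕ) :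
    Set.InjOn (fun r => f r + (k - (r + 1))) (Finset.range k : Finset ℕ) := by
  intro r hr s hs h
  simp only [Finset.coe_range, Set.mem_Iio] at hr hs h
  refine hf.strictAnti.injective ?_
  omega

theorem card_betaSet {f : ℕ → ℕ} (hf : IsPartition f) (k : ℕ) : (betaSet f k).card = k := by
  rw [betaSet, Finset.card_image_of_injOn (injOn_beta hf k), Finset.card_range]

theorem sum_card_rows {f : ℕ → ℕ} (hf : IsPartition f) (e k : ℕ) (i : ZMod e) :
    ∑ r ∈ Finset.range k,
      (((Finset.range (f r)).filter fun c : ℕ => (c : ZMod e) - r + k = i).card : ℤ) =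
      residueCount e f k i := by
  rw [residueCount, betaSet, Finset.sum_image (injOn_beta hf k),
    ← Finset.sum_range_reflect (fun b => beads e (Finset.range (b + 1)) i), ← Finset.sum_sub_distrib]
  refine Finset.sum_congr rfl fun r hr => ?_
  rw [card_row e i (f r) r k (Finset.mem_range.1 hr), Nat.sub_sub, Nat.add_comm 1 r]

theorem cnt_eq {e : ℕ} {κ : Fin 2 → ZMod e} {lam : Fin 2 → ℕ → ℕ} (hlam : IsBipartition lam)
    {k₁ k₂ : ℕ} (hk : IsBicharge e κ lam k₁ k₂) (i : ZMod e) :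
    (cnt e κ lam i : ℤ) = residueCount e (lam 0) k₁ i + residueCount e (lam 1) k₂ i := by
  obtain ⟨hk1, hk2, hl1, hl2⟩ := hk
  rw [← sum_card_rows (hlam 0), ← sum_card_rows (hlam 1), hk1, hk2]
  let F : Finset (Σ _ : Fin 2, Σ _ : ℕ, ℕ) := Finset.univ.sigma fun a =>
    (Finset.range (![k₁, k₂] a)).sigma fun r =>
      (Finset.range (lam a r)).filter fun c : ℕ => (c : ZMod e) - r + κ a = i
  have hF : {x : Node | x ∈ Diagram lam ∧ res e κ x = i} =
      ↑(F.image fun y => ((y.2.1, y.2.2, y.1) : Node)) := by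
    ext ⟨r, c, a⟩
    simp only [F, Diagram, res, Finset.coe_image, Set.mem_image, Finset.mem_coe, Finset.mem_sigma,
      Finset.mem_filter, Finset.mem_range, Finset.mem_univ, true_and, Set.mem_ofPred_eq,
      Prod.mk.injEq]
    constructor
    · rintro ⟨h1, h2⟩
      refine ⟨⟨a, r, c⟩, ⟨?_, h1, h2⟩, rfl, rfl, rfl⟩
      have hz : ∀ k, len (lam a) ≤ k → r < k := fun k hk => by
        by_contra hrk
        have := (hlam a).eq_zero_of_len_le hk (not_lt.1 hrk)
        omega
      fin_cases a
      · exact hz _ hl1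
      · exact hz _ hl2
    · rintro ⟨⟨a, r, c⟩, ⟨-, h1, h2⟩, rfl, rfl, rfl⟩
      exact ⟨h1, h2⟩
  have hinj : Function.Injective
      fun y : (Σ _ : Fin 2, Σ _ : ℕ, ℕ) => ((y.2.1, y.2.2, y.1) : Node) := by
    rintro ⟨a, r, c⟩ ⟨a', r', c'⟩ h
    simp only [Prod.mk.injEq] at h
    obtain ⟨rfl, rfl, rfl⟩ := h
    rfl
  rw [cnt, hF, Set.ncard_coe_finset, Finset.card_image_of_injective _ hinj]
  simp only [F, Finset.card_sigma, Fin.sum_univ_two, Matrix.cons_val_zero, Matrix.cons_val_one]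
  push_cast
  rfl

theorem residueCount_sub {f : ℕ → ℕ} (hf : IsPartition f) (e k : ℕ) (i : ZMod e) :
    residueCount e f k i - residueCount e f k (i + 1) =
      beads e (betaSet f k) i - beads e (Finset.range k) i := by
  have h : ∀ b : ℕ, beads e (Finset.range (b + 1)) i - beads e (Finset.range (b + 1)) (i + 1) =
      (if (b : ZMod e) = i then 1 else 0) - if (0 : ZMod e) = i + 1 then 1 else 0 := fun b => by
    rw [beads_range_succ, beads_range_succ']
    ring
  rw [residueCount, residueCount, sub_sub_sub_comm, ← Finset.sum_sub_distrib,
    ← Finset.sum_sub_distrib, Finset.sum_congr rfl fun b _ => h b,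
    Finset.sum_congr (s₁ := Finset.range k) rfl fun b _ => h b, Finset.sum_sub_distrib,
    Finset.sum_sub_distrib, Finset.sum_const, Finset.sum_const, card_betaSet hf, Finset.card_range,
    beads_eq_sum, beads_eq_sum]
  ring

theorem two_mul_residueCount_zero {f : ℕ → ℕ} (hf : IsPartition f) (e k : ℕ) [NeZero e] :
    2 * residueCount e f k 0 = abacusWeight e (betaSet f k) +
      ∑ x : ZMod e, (beads e (betaSet f k) x * (beads e (betaSet f k) x - 1) -
        beads e (Finset.range k) x * (beads e (Finset.range k) x - 1)) := by
  have h1 := two_mul_sum_div e (betaSet f k)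
  have h2 := two_mul_sum_div e (Finset.range k)
  rw [(abacusWeight_nonneg_and_eq_zero_iff e _).2.2 (isFlush_range e k)] at h2
  simp only [residueCount, beads_range_succ_zero, Finset.sum_add_distrib, Finset.sum_const,
    card_betaSet hf, Finset.card_range, Finset.sum_sub_distrib]
  linarith

theorem residueCount_natCast {f : ℕ → ℕ} (hf : IsPartition f) (e k l : ℕ) [NeZero e] :
    residueCount e f k (l : ZMod e) = residueCount e f k 0 -
      ∑ x : ZMod e, (beads e (betaSet f k) x - beads e (Finset.range k) x) *
        beads e (Finset.range l) x := by
  rw [← sum_range_natCast_eq e l fun x => beads e (betaSet f k) x - beads e (Finset.range k) x]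
  simp only [← residueCount_sub hf]
  have := Finset.sum_range_sub' (fun j : ℕ => residueCount e f k (j : ZMod e)) l
  push_cast at this
  rw [this]
  ring

theorem sum_range_natCast_zmod {M : Type*} [AddCommMonoid M] (e : ℕ) [NeZero e] (g : ZMod e → M) :
    ∑ j ∈ Finset.range e, g j = ∑ x, g x := by
  refine Finset.sum_nbij' (fun j => (j : ZMod e)) ZMod.val (by simp)
    (fun x _ => Finset.mem_range.2 (ZMod.val_lt x))
    (fun j hj => ZMod.val_cast_of_lt (Finset.mem_range.1 hj)) (by simp) (by simp)

theorem two_mul_wt {e : ℕ} [NeZero e] {κ : Fin 2 → ZMod e} {lam : Fin 2 → ℕ → ℕ}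
    (hlam : IsBipartition lam) {k₁ k₂ : ℕ} (hk : IsBicharge e κ lam k₁ k₂) :
    2 * wt e κ lam =
      ((2 * (abacusWeight e (betaSet (lam 0) k₁) + abacusWeight e (betaSet (lam 1) k₂)) +
        ∑ x, (gamma e lam k₁ k₂ x ^ 2 -
          (beads e (Finset.range k₂) x - beads e (Finset.range k₁) x) ^ 2) : ℤ) : ℚ) := by
  have hcnt := cnt_eq hlam hk
  have hsq : ∑ j ∈ Finset.range e,
      ((cnt e κ lam (j : ZMod e) : ℚ) - (cnt e κ lam ((j : ZMod e) + 1) : ℚ)) ^ 2 =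
      ((∑ x, (beads e (betaSet (lam 0) k₁) x - beads e (Finset.range k₁) x +
        (beads e (betaSet (lam 1) k₂) x - beads e (Finset.range k₂) x)) ^ 2 : ℤ) : ℚ) := by
    rw [sum_range_natCast_zmod e fun x =>
      ((cnt e κ lam x : ℚ) - (cnt e κ lam (x + 1) : ℚ)) ^ 2]
    push_cast
    refine Finset.sum_congr rfl fun x _ => ?_
    have h : (cnt e κ lam x : ℤ) - cnt e κ lam (x + 1) =
        beads e (betaSet (lam 0) k₁) x - beads e (Finset.range k₁) x +
          (beads e (betaSet (lam 1) k₂) x - beads e (Finset.range k₂) x) := by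
      rw [hcnt, hcnt, add_sub_add_comm, residueCount_sub (hlam 0), residueCount_sub (hlam 1)]
    have h' := congrArg (fun z : ℤ => (z : ℚ) ^ 2) h
    push_cast at h'
    exact h'
  have hint : 2 * wt e κ lam = ((2 * (cnt e κ lam (κ 0) : ℤ) + 2 * cnt e κ lam (κ 1) -
      ∑ x, (beads e (betaSet (lam 0) k₁) x - beads e (Finset.range k₁) x +
        (beads e (betaSet (lam 1) k₂) x - beads e (Finset.range k₂) x)) ^ 2 : ℤ) : ℚ) := by
    rw [wt, hsq]
    push_cast
    ring
  rw [hint, Int.cast_inj, hcnt, hcnt, ← hk.1, ← hk.2.1]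
  simp only [residueCount_natCast (hlam 0), residueCount_natCast (hlam 1)]
  have h0 := two_mul_residueCount_zero (hlam 0) e k₁
  have h1 := two_mul_residueCount_zero (hlam 1) e k₂
  have s0 : ∑ x, (beads e (betaSet (lam 0) k₁) x - beads e (Finset.range k₁) x) = 0 := by
    rw [Finset.sum_sub_distrib, sum_beads, sum_beads, card_betaSet (hlam 0), Finset.card_range,
      sub_self]
  have s1 : ∑ x, (beads e (betaSet (lam 1) k₂) x - beads e (Finset.range k₂) x) = 0 := by
    rw [Finset.sum_sub_distrib, sum_beads, sum_beads, card_betaSet (hlam 1), Finset.card_range,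
      sub_self]
  have hgam : ∀ x, gamma e lam k₁ k₂ x =
    beads e (betaSet (lam 0) k₁) x - beads e (betaSet (lam 1) k₂) x := fun _ => rfl
  simp only [hgam]
  generalize beads e (betaSet (lam 0) k₁) = n₁ at *
  generalize beads e (betaSet (lam 1) k₂) = n₂ at *
  generalize beads e (Finset.range k₁) = m₁ at *
  generalize beads e (Finset.range k₂) = m₂ at *
  have key : ∑ x, ((n₁ x - n₂ x) ^ 2 - (m₂ x - m₁ x) ^ 2) =
      2 * ∑ x, (n₁ x * (n₁ x - 1) - m₁ x * (m₁ x - 1)) +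
      2 * ∑ x, (n₂ x * (n₂ x - 1) - m₂ x * (m₂ x - 1)) -
      2 * ∑ x, (n₁ x - m₁ x) * m₁ x - 2 * ∑ x, (n₁ x - m₁ x) * m₂ x -
      2 * ∑ x, (n₂ x - m₂ x) * m₁ x - 2 * ∑ x, (n₂ x - m₂ x) * m₂ x -
      ∑ x, (n₁ x - m₁ x + (n₂ x - m₂ x)) ^ 2 +
      2 * ∑ x, (n₁ x - m₁ x) + 2 * ∑ x, (n₂ x - m₂ x) := by
    simp only [Finset.mul_sum, ← Finset.sum_add_distrib, ← Finset.sum_sub_distrib]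
    exact Finset.sum_congr rfl fun x _ => by ring
  rw [key, s0, s1]
  linarith

theorem sum_sq_sub_nonneg_and_eq_zero_iff {ι : Type*} [Fintype ι] {g u : ι → ℤ} {q : ℤ}
    (hu : ∀ x, u x = q ∨ u x = q + 1) (hsum : ∑ x, g x = -∑ x, u x) :
    0 ≤ ∑ x, (g x ^ 2 - u x ^ 2) ∧
      (∑ x, (g x ^ 2 - u x ^ 2) = 0 ↔ ∀ x y, g x - g y ≤ 1) := by
  have hu' : ∀ x, (u x - q) * (u x - q - 1) = 0 := fun x => by
    rcases hu x with h | h <;> rw [h] <;> ring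
  have hrew : ∑ x, (g x ^ 2 - u x ^ 2) = ∑ x, (g x + q) * (g x + q + 1) := by
    have h1 : ∑ x, (g x + q) * (g x + q + 1) - ∑ x, (g x ^ 2 - u x ^ 2) =
        ∑ x, (u x - q) * (u x - q - 1) + (2 * q + 1) * (∑ x, g x + ∑ x, u x) := by
      rw [← Finset.sum_sub_distrib, ← Finset.sum_add_distrib, Finset.mul_sum,
        ← Finset.sum_add_distrib]
      exact Finset.sum_congr rfl fun x _ => by ring
    rw [hsum, Finset.sum_eq_zero fun x _ => hu' x] at h1
    linarith
  have hnn : ∀ x ∈ Finset.univ, 0 ≤ (g x + q) * (g x + q + 1) := fun x _ => by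
    rcases le_or_gt 0 (g x + q) with h | h
    · positivity
    · exact mul_nonneg_of_nonpos_of_nonpos h.le (by omega)
  have hsum' : ∑ x, g x = ∑ x, -u x := by rw [hsum, Finset.sum_neg_distrib]
  rw [hrew]
  refine ⟨Finset.sum_nonneg hnn, ?_⟩
  rw [Finset.sum_eq_zero_iff_of_nonneg hnn]
  constructor
  · intro h x y
    have hx := mul_eq_zero.1 (h x (Finset.mem_univ _))
    have hy := mul_eq_zero.1 (h y (Finset.mem_univ _))
    omega
  · intro h x _
    rw [mul_eq_zero]
    by_contra! hne
    rcases lt_or_gt_of_ne hne.1 with hlt | hgt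
    · refine absurd hsum' (Finset.sum_lt_sum (fun y _ => ?_) ⟨x, Finset.mem_univ _, ?_⟩).ne
      · have := h y x
        have := hu y
        omega
      · have := hu x
        omega
    · refine absurd hsum' (Finset.sum_lt_sum (fun y _ => ?_) ⟨x, Finset.mem_univ _, ?_⟩).ne'
      · have := h x y
        have := hu y
        omega
      · have := hu x
        omega

theorem exists_isBicharge (e : ℕ) [NeZero e] (κ : Fin 2 → ZMod e) (lam : Fin 2 → ℕ → ℕ) :
    ∃ k₁ k₂, IsBicharge e κ lam k₁ k₂ := by
  refine ⟨(κ 0).val + e * len (lam 0), (κ 1).val + e * len (lam 1), by simp, by simp, ?_, ?_⟩ <;>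
  exact le_add_left (Nat.le_mul_of_pos_left _ (NeZero.pos e))

theorem wt_eq_zero_iff_of_isBicharge {e : ℕ} [NeZero e] {κ : Fin 2 → ZMod e}
    {lam : Fin 2 → ℕ → ℕ} (hlam : IsBipartition lam) {k₁ k₂ : ℕ}
    (hk : IsBicharge e κ lam k₁ k₂) :
    wt e κ lam = 0 ↔ IsBicore e lam ∧
      ∀ x y : ZMod e, gamma e lam k₁ k₂ x - gamma e lam k₁ k₂ y ≤ 1 := by
  obtain ⟨q, hq⟩ := beads_range_sub_bounds e k₁ k₂
  have hsum : ∑ x, gamma e lam k₁ k₂ x =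
      -∑ x, (beads e (Finset.range k₂) x - beads e (Finset.range k₁) x) := by
    change ∑ x, (beads e (betaSet (lam 0) k₁) x - beads e (betaSet (lam 1) k₂) x) = _
    simp only [Finset.sum_sub_distrib, sum_beads, card_betaSet (hlam 0), card_betaSet (hlam 1),
      Finset.card_range]
    ring
  have hg := sum_sq_sub_nonneg_and_eq_zero_iff hq hsum
  have h0 := abacusWeight_nonneg_and_eq_zero_iff e (betaSet (lam 0) k₁)
  have h1 := abacusWeight_nonneg_and_eq_zero_iff e (betaSet (lam 1) k₂)
  have hcore : IsBicore e lam ↔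
      IsFlush e (betaSet (lam 0) k₁) ∧ IsFlush e (betaSet (lam 1) k₂) := by
    rw [isBicore_iff hlam (NeZero.pos e), Fin.forall_fin_two,
      isFlush_betaSet_iff (hlam 0) hk.2.2.1, isFlush_betaSet_iff (hlam 1) hk.2.2.2]
  have hwt := two_mul_wt hlam hk
  have hz : wt e κ lam = 0 ↔ 2 * wt e κ lam = 0 := by simp
  rw [hz, hwt, Int.cast_eq_zero, hcore, ← h0.2, ← h1.2, ← hg.2]
  constructor
  · intro h
    refine ⟨⟨?_, ?_⟩, ?_⟩ <;> linarith [h0.1, h1.1, hg.1]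
  · rintro ⟨⟨h, h'⟩, h''⟩
    rw [h, h', h'']
    norm_num

/-! The statement. -/

theorem stmt9 (e : ℕ) (he : 2 ≤ e) (κ : Fin 2 → ZMod e) (lam : Fin 2 → ℕ → ℕ)
    (hlam : IsBipartition lam) :
    wt e κ lam = 0 ↔
      (IsBicore e lam ∧ ∀ k₁ k₂ : ℕ, IsBicharge e κ lam k₁ k₂ →
        ∀ x y : ZMod e, gamma e lam k₁ k₂ x - gamma e lam k₁ k₂ y ≤ 1) := by
  have : NeZero e := ⟨by omega⟩
  constructor
  · intro h
    obtain ⟨k₁, k₂, hk⟩ := exists_isBicharge e κ lam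
    exact ⟨((wt_eq_zero_iff_of_isBicharge hlam hk).1 h).1, fun k₁ k₂ hk =>
      ((wt_eq_zero_iff_of_isBicharge hlam hk).1 h).2⟩
  · rintro ⟨hcore, h⟩
    obtain ⟨k₁, k₂, hk⟩ := exists_isBicharge e κ lam
    exact (wt_eq_zero_iff_of_isBicharge hlam hk).2 ⟨hcore, h k₁ k₂ hk⟩

end Wt3
end

section
/- Fix an integer e ≥ 2 and an offset k ∈ ℤ/eℤ. If λ is an e-core partition (a partition with no rim e-hooks), then for every i ∈ ℤ/eℤ, λ does not have both an addable node of residue i and a removable node of residue i. -/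
namespace Wt3

/-! The statement. -/

/-- `z` is a bead of the (charge zero) infinite beta-set `{f r - r}`. -/
def IsBead (f : ℕ → ℕ) (z : ℤ) : Prop := ∃ r : ℕ, (f r : ℤ) - r = z

theorem mem_diagram1 {f : ℕ → ℕ} {r c : ℕ} : (r, c) ∈ Diagram1 f ↔ c < f r := Iff.rfl

/-- The row in which the rim meets the diagonal of content `d`, below a row exceeding `d`. -/
theorem IsPartition.exists_rim_row {f : ℕ → ℕ} (hf : IsPartition f) {p : ℕ} {d : ℤ}
    (hp : d < (f p : ℤ) - p) :
    ∃ r : ℕ, d < (f r : ℤ) - r ∧ (f (r + 1) : ℤ) - (r + 1) ≤ d := by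
  by_contra! h
  have key : ∀ n : ℕ, d < (f (p + n) : ℤ) - (p + n : ℕ) := by
    intro n
    induction n with
    | zero => exact hp
    | succ n ih => exact_mod_cast h (p + n) ih
  obtain ⟨N, hN⟩ := hf.2
  have h1 := key (N + d.natAbs)
  rw [hN _ (by omega)] at h1
  omega

theorem IsAddable1.bead {f : ℕ → ℕ} (hf : IsPartition f) {x : Node1} (hx : IsAddable1 f x) :
    IsBead f ((x.2 : ℤ) - x.1) ∧ ¬ IsBead f ((x.2 : ℤ) - x.1 + 1) := by
  obtain ⟨a, c⟩ := x
  obtain ⟨hx, g, hg, hgf⟩ := hx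
  have key : ∀ r s, s < g r ↔ s < f r ∨ (r = a ∧ s = c) := by
    intro r s
    have := Set.ext_iff.1 hgf (r, s)
    simpa [mem_diagram1, or_comm] using this
  rw [mem_diagram1] at hx
  have hga : c < g a := (key a c).2 (by simp)
  have hfa : f a = c := by
    rcases (key a (f a)).1 (by omega) with h | h <;> omega
  refine ⟨⟨a, by simp [hfa]⟩, ?_⟩
  rintro ⟨r, hr⟩
  simp only at hr
  rcases le_or_gt a r with h | h
  · have := hf.antitone h
    omega
  · have h1 := hf.antitone (show r ≤ a - 1 by omega)
    have h2 := hg.antitone (show a - 1 ≤ a by omega)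
    rcases (key (a - 1) c).1 (by omega) with h3 | h3 <;> omega

theorem IsRemovable1.bead {f : ℕ → ℕ} (hf : IsPartition f) {x : Node1} (hx : IsRemovable1 f x) :
    IsBead f ((x.2 : ℤ) - x.1 + 1) ∧ ¬ IsBead f ((x.2 : ℤ) - x.1) := by
  obtain ⟨b, c⟩ := x
  obtain ⟨hx, g, hg, hgf⟩ := hx
  have key : ∀ r s, s < g r ↔ s < f r ∧ ¬ (r = b ∧ s = c) := by
    intro r s
    have := Set.ext_iff.1 hgf (r, s)
    simpa [mem_diagram1, or_comm] using this
  rw [mem_diagram1] at hx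
  have hgb : ¬ c < g b := fun h => ((key b c).1 h).2 ⟨rfl, rfl⟩
  have hfb : f b = c + 1 := by
    by_contra hne
    have := (key b (c + 1)).2 ⟨by omega, by omega⟩
    omega
  refine ⟨⟨b, by simp only [hfb]; push_cast; ring⟩, ?_⟩
  rintro ⟨r, hr⟩
  simp only at hr
  rcases le_or_gt r b with h | h
  · have := hf.antitone h
    omega
  · have h1 := hf.antitone (show b + 1 ≤ r by omega)
    have h2 := hg.1 b
    have h3 : ¬ c < f (b + 1) := fun h3 => by
      have := (key (b + 1) c).2 ⟨h3, by omega⟩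
      omega
    omega

/-- A bead with a gap `e` places before it yields a rim `e`-hook. -/
theorem IsPartition.exists_rimHook {f : ℕ → ℕ} (hf : IsPartition f) {e : ℕ} (he : 0 < e) {x : ℤ}
    (hx : IsBead f x) (hgap : ¬ IsBead f (x - e)) :
    ∃ H : Finset Node1, IsRimHook1 f H ∧ H.card = e := by
  obtain ⟨p, hp⟩ := hx
  have hgap' : ∀ r : ℕ, (f r : ℤ) - r ≠ x - e := fun r hr => hgap ⟨r, hr⟩
  have hanti : ∀ {r s : ℕ}, r ≤ s → f s ≤ f r := fun h => hf.antitone h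
  have hex : ∀ j : ℕ, ∃ y : Node1, j < e →
      (y.2 : ℤ) - y.1 = x - e + j ∧ y.2 < f y.1 ∧ f (y.1 + 1) ≤ y.2 + 1 := by
    intro j
    by_cases hj : j < e
    · obtain ⟨r, h1, h2⟩ := hf.exists_rim_row (p := p) (d := x - e + j) (by omega)
      have hnonneg : 0 ≤ x - e + j + r := by
        by_contra! hneg
        have h3 := hanti (show r + 1 ≤ (e - x).toNat by omega)
        exact hgap' (e - x).toNat (by omega)
      refine ⟨(r, (x - e + j + r).toNat), fun _ => ?_⟩
      dsimp only
      omega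
    · exact ⟨(0, 0), fun h => absurd h hj⟩
  choose node hnode using hex
  have hmem : ∀ r c : ℕ, (r, c) ∈ (Finset.range e).image node ↔
      x - e ≤ (c : ℤ) - r ∧ (c : ℤ) - r < x ∧ c < f r ∧ f (r + 1) ≤ c + 1 := by
    intro r c
    simp only [Finset.mem_image, Finset.mem_range]
    constructor
    · rintro ⟨j, hj, h⟩
      have := hnode j hj
      rw [h] at this
      dsimp only at this
      omega
    · rintro ⟨h1, h2, h3, h4⟩
      refine ⟨((c : ℤ) - r - (x - e)).toNat, by omega, ?_⟩
      obtain ⟨k1, k2, k3⟩ := hnode ((c : ℤ) - r - (x - e)).toNat (by omega)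
      generalize node ((c : ℤ) - r - (x - e)).toNat = y at *
      obtain ⟨s, d⟩ := y
      dsimp only at k1 k2 k3
      have hs : s = r := by
        rcases lt_trichotomy s r with h | h | h
        · have := hanti (show s + 1 ≤ r from h)
          omega
        · exact h
        · have := hanti (show r + 1 ≤ s from h)
          omega
      subst hs
      simp only [Prod.mk.injEq, true_and]
      omega
  have hcard : ((Finset.range e).image node).card = e := by
    rw [Finset.card_image_of_injOn, Finset.card_range]
    intro i hi j hj hij
    have h1 := (hnode i (by simpa using hi)).1
    have h2 := (hnode j (by simpa using hj)).1
    rw [hij] at h1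
    omega
  refine ⟨(Finset.range e).image node, ⟨?_, ?_, ?_, ?_⟩, hcard⟩
  · exact ⟨node 0, Finset.mem_image_of_mem _ (Finset.mem_range.2 he)⟩
  · rintro ⟨r, c⟩ h
    have := (hmem r c).1 h
    simp only [Rim1, Set.mem_ofPred_eq, mem_diagram1]
    omega
  · refine ⟨(List.range e).map node, List.isChain_iff_getElem.2 ?_, by simp⟩
    intro j hj
    simp only [List.length_map, List.length_range] at hj
    simp only [List.getElem_map, List.getElem_range]
    obtain ⟨k1, k2, k3⟩ := hnode j (by omega)
    obtain ⟨l1, l2, l3⟩ := hnode (j + 1) hj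
    generalize node j = y at *
    generalize node (j + 1) = z at *
    obtain ⟨r, c⟩ := y
    obtain ⟨s, d⟩ := z
    dsimp only [Step1] at *
    rcases lt_trichotomy s r with h | h | h
    · have := hanti (show s + 1 ≤ r from h)
      omega
    · omega
    · have := hanti (show r + 1 ≤ s from h)
      omega
  · refine ⟨fun r => if r < p then f r else min (f r) (max (r + x - e).toNat (f (r + 1) - 1)),
      ⟨fun r => ?_, ?_⟩, ?_⟩
    · have h1 := hf.1 r
      have h2 := hf.1 (r + 1)
      have h3 := hgap' (r + 1)
      dsimp only
      split_ifs <;> omega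
    · obtain ⟨N, hN⟩ := hf.2
      refine ⟨N, fun r hr => ?_⟩
      simp [hN r hr]
    · ext ⟨r, c⟩
      rw [Set.mem_sdiff, Finset.mem_coe, hmem, mem_diagram1, mem_diagram1]
      split_ifs with h
      · have := hanti (show r + 1 ≤ p from h)
        omega
      · have := hanti (show p ≤ r by omega)
        omega

/-- The beta-set of an `e`-core is closed under moving a bead back by multiples of `e`. -/
theorem IsECore.bead_sub {f : ℕ → ℕ} {e : ℕ} (hcore : IsECore e f) (he : 0 < e)
    (hf : IsPartition f) {z : ℤ} (hz : IsBead f z) (t : ℕ) : IsBead f (z - t * e) := by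
  induction t with
  | zero => simpa using hz
  | succ t ih =>
    by_contra h
    refine hcore (hf.exists_rimHook he ih ?_)
    convert h using 2
    push_cast
    ring

theorem stmt11 (e : ℕ) (he : 2 ≤ e) (k : ZMod e) (f : ℕ → ℕ)
    (hf : IsPartition f) (hcore : IsECore e f) (i : ZMod e) :
    ¬ ((∃ x : Node1, IsAddable1 f x ∧ res1 e k x = i) ∧
        (∃ x : Node1, IsRemovable1 f x ∧ res1 e k x = i)) := by
  rintro ⟨⟨x, hx, hxi⟩, ⟨y, hy, hyi⟩⟩
  obtain ⟨ha, ha'⟩ := hx.bead hf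
  obtain ⟨hr, hr'⟩ := hy.bead hf
  have hres : (((x.2 : ℤ) - x.1 : ℤ) : ZMod e) = (((y.2 : ℤ) - y.1 : ℤ) : ZMod e) := by
    push_cast
    exact add_right_cancel (hxi.trans hyi.symm)
  obtain ⟨t, ht⟩ := ((ZMod.intCast_eq_intCast_iff_dvd_sub _ _ e).1 hres)
  have hpos : 0 < e := by omega
  rcases le_total 0 t with h | h
  · refine ha' ?_
    convert hcore.bead_sub hpos hf hr t.toNat using 1
    rw [Int.toNat_of_nonneg h]
    linarith
  · refine hr' ?_
    convert hcore.bead_sub hpos hf ha (-t).toNat using 1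
    rw [Int.toNat_of_nonneg (by omega)]
    linarith

end Wt3
end

section
/- Fix an integer e ≥ 2 and κ = (κ₁, κ₂) ∈ (ℤ/eℤ)². Suppose λ is a bipartition with wt(λ) = 3 and i ∈ ℤ/eℤ satisfies δ_i(λ) ≥ 3. Then λ has no addable i-node. -/
namespace Wt3

theorem isRemovable_imp {lam : Fin 2 → ℕ → ℕ} {r c : ℕ} {a : Fin 2}
    (h : IsRemovable lam (r, c, a)) : lam a (r + 1) < lam a r ∧ c + 1 = lam a r := by
  obtain ⟨hx, mu, hmu, hd⟩ := h
  have key : ∀ r' c', c' < mu a r' ↔ c' < lam a r' ∧ ¬ (r' = r ∧ c' = c) := by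
    intro r' c'
    have := Set.ext_iff.1 hd (r', c', a)
    simpa [Diagram] using this
  have hx : c < lam a r := hx
  have h1 := key r c
  have h2 := key r (c + 1)
  have h3 := key (r + 1) c
  have h4 := (hmu a).1 r
  simp at h1 h2 h3
  omega

theorem isAddable_iff {lam : Fin 2 → ℕ → ℕ} (hlam : IsBipartition lam) {r c : ℕ} {a : Fin 2} :
    IsAddable lam (r, c, a) ↔ c = lam a r ∧ (r = 0 ∨ lam a r < lam a (r - 1)) := by
  constructor
  · rintro ⟨hx, mu, hmu, hd⟩
    have key : ∀ r' c', c' < mu a r' ↔ c' < lam a r' ∨ (r' = r ∧ c' = c) := by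
      intro r' c'
      have := Set.ext_iff.1 hd (r', c', a)
      simpa [Diagram, or_comm] using this
    have hx : ¬ c < lam a r := hx
    have h1 := key r c
    have h2 := key r (c - 1)
    have hc : c = lam a r := by
      simp at h1 h2
      omega
    refine ⟨hc, ?_⟩
    rcases Nat.eq_zero_or_pos r with h0 | h0
    · exact Or.inl h0
    · right
      have h3 := key (r - 1) c
      have h4 := (hmu a).1 (r - 1)
      rw [Nat.sub_add_cancel h0] at h4
      simp at h1
      omega
  · rintro ⟨rfl, hr⟩
    refine ⟨by simp [Diagram], Function.update lam a (Function.update (lam a) r (lam a r + 1)),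
      ?_, ?_⟩
    · intro b
      by_cases hb : b = a
      · subst hb
        simp only [Function.update_self]
        refine ⟨fun s => ?_, ?_⟩
        · have := (hlam b).1 s
          simp only [Function.update_apply]
          split_ifs with h1 h2 h2
          · omega
          · have : s = r - 1 := by omega
            subst this
            have : r ≠ 0 := by omega
            omega
          · subst h2
            omega
          · exact this
        · obtain ⟨N, hN⟩ := (hlam b).2
          refine ⟨N + r + 1, fun s hs => ?_⟩
          rw [Function.update_of_ne (by omega)]
          exact hN s (by omega)
      · rw [Function.update_of_ne hb]
        exact hlam b
    · ext ⟨s, d, b⟩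
      by_cases hb : b = a
      · subst hb
        by_cases hs : s = r
        · subst hs
          simp [Diagram]
          omega
        · simp [Diagram, hs]
      · simp [Diagram, hb]

/-- Number of nodes of residue `j` in the first `k` rows of a partition of charge `κ`. -/
def rowCount (e : ℕ) (κ : ZMod e) (f : ℕ → ℕ) (k : ℕ) (j : ZMod e) : ℤ :=
  ∑ r ∈ Finset.range k, ∑ c ∈ Finset.range (f r), if (c : ZMod e) - r + κ = j then 1 else 0

/-- Rows, among the first `k`, ending in a removable `i`-node. -/
def remRows (e : ℕ) (κ : ZMod e) (f : ℕ → ℕ) (k : ℕ) (i : ZMod e) : Finset ℕ :=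
  (Finset.range k).filter fun r => f (r + 1) < f r ∧ (f r : ZMod e) - 1 - r + κ = i

/-- Rows, among the first `k`, to which an `i`-node can be added. -/
def addRows (e : ℕ) (κ : ZMod e) (f : ℕ → ℕ) (k : ℕ) (i : ZMod e) : Finset ℕ :=
  (Finset.range k).filter fun r => (r = 0 ∨ f r < f (r - 1)) ∧ (f r : ZMod e) - r + κ = i

theorem rowCount_sub (e : ℕ) (κ : ZMod e) (f : ℕ → ℕ) (k : ℕ) (j : ZMod e) :
    rowCount e κ f k j - rowCount e κ f k (j + 1) =
      ∑ r ∈ Finset.range k, ((if (f r : ZMod e) - 1 - r + κ = j then 1 else 0) -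
        if -1 - (r : ZMod e) + κ = j then 1 else 0 : ℤ) := by
  unfold rowCount
  rw [← Finset.sum_sub_distrib]
  refine Finset.sum_congr rfl fun r _ => ?_
  generalize f r = n
  rw [← Finset.sum_sub_distrib]
  induction n with
  | zero => simp
  | succ n ih =>
    rw [Finset.sum_range_succ, ih]
    have h1 : (n : ZMod e) - r + κ = j + 1 ↔ (n : ZMod e) - 1 - r + κ = j :=
      ⟨fun h => by linear_combination h, fun h => by linear_combination h⟩
    have h2 : (((n + 1 : ℕ) : ZMod e)) - 1 - r + κ = j ↔ (n : ZMod e) - r + κ = j := by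
      push_cast
      exact ⟨fun h => by linear_combination h, fun h => by linear_combination h⟩
    simp only [h1, h2]
    ring

theorem sum_end_residues {e : ℕ} (κ : ZMod e) {f : ℕ → ℕ} (hf : ∀ r, f (r + 1) ≤ f r) (m : ℕ)
    (i : ZMod e) :
    ∑ r ∈ Finset.range (m + 1), ((if (f r : ZMod e) - 1 - r + κ = i then 1 else 0) -
        if (f r : ZMod e) - r + κ = i then 1 else 0 : ℤ) =
      (remRows e κ f (m + 1) i).card - (addRows e κ f (m + 1) i).card +
        if f (m + 1) = f m ∧ (f m : ZMod e) - 1 - m + κ = i then 1 else 0 := by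
  unfold remRows addRows
  simp only [Finset.card_filter]
  push_cast
  induction m with
  | zero =>
    simp only [zero_add, Finset.sum_range_one]
    rcases (hf 0).lt_or_eq with h | h <;> rw [zero_add] at h
    · simp only [h, h.ne, true_or, true_and, false_and, if_false, add_zero]
    · simp only [h, lt_irrefl, true_or, true_and, false_and, if_false]
      ring
  | succ m ih =>
    rw [Finset.sum_range_succ, ih, Finset.sum_range_succ _ (m + 1), Finset.sum_range_succ _ (m + 1)]
    have h3 : f (m + 1) = f m → ((f (m + 1) : ZMod e) - ((m + 1 : ℕ) : ZMod e) + κ = i ↔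
        (f m : ZMod e) - 1 - m + κ = i) := by
      intro h
      rw [h]
      push_cast
      exact ⟨fun h => by linear_combination h, fun h => by linear_combination h⟩
    have h4 : (m + 1 = 0 ∨ f (m + 1) < f (m + 1 - 1)) ↔ f (m + 1) < f m := by simp
    simp only [h4]
    rcases (hf m).lt_or_eq with h | h <;> rcases (hf (m + 1)).lt_or_eq with h' | h'
    · simp only [h, h', h.ne, h'.ne, true_and, false_and, if_false]
      ring
    · simp only [h, h', h.ne, lt_irrefl, true_and, false_and, if_false]
      ring
    · rw [if_congr (h3 h) rfl rfl]
      simp only [h', h'.ne, h.not_lt, true_and, false_and, if_false]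
      simp only [h, true_and]
      ring
    · rw [if_congr (h3 h) rfl rfl]
      simp only [h', h.not_lt, lt_irrefl, true_and, false_and, if_false]
      simp only [h, true_and]
      ring

theorem sum_empty_residues (e : ℕ) (κ : ZMod e) (k : ℕ) (i : ZMod e) :
    ∑ r ∈ Finset.range k, ((if -1 - (r : ZMod e) + κ = i then 1 else 0) -
        if -(r : ZMod e) + κ = i then 1 else 0 : ℤ) =
      (if -(k : ZMod e) + κ = i then 1 else 0) - if κ = i then 1 else 0 := by
  have h := Finset.sum_range_sub
    (fun r : ℕ => (if -(r : ZMod e) + κ = i then 1 else 0 : ℤ)) k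
  simp only [Nat.cast_zero, neg_zero, zero_add] at h
  rw [← h]
  refine Finset.sum_congr rfl fun r _ => ?_
  have : -((r + 1 : ℕ) : ZMod e) + κ = -1 - (r : ZMod e) + κ := by
    push_cast
    ring
  rw [this]

theorem rowCount_second_difference {e : ℕ} (κ : ZMod e) {f : ℕ → ℕ} (hf : ∀ r, f (r + 1) ≤ f r)
    {m : ℕ} (hm : f m = 0) (i : ZMod e) :
    (rowCount e κ f (m + 1) i - rowCount e κ f (m + 1) (i + 1)) -
        (rowCount e κ f (m + 1) (i - 1) - rowCount e κ f (m + 1) (i - 1 + 1)) =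
      (remRows e κ f (m + 1) i).card - (addRows e κ f (m + 1) i).card +
        if κ = i then 1 else 0 := by
  have h1 := sum_end_residues κ hf m i
  have h2 := sum_empty_residues e κ (m + 1) i
  have h3 := hf m
  have h4 : f (m + 1) = 0 := by omega
  have h5 : (-((m + 1 : ℕ) : ZMod e) + κ = i) ↔ (((0 : ℕ) : ZMod e) - 1 - m + κ = i) := by
    push_cast
    exact ⟨fun h => by linear_combination h, fun h => by linear_combination h⟩
  rw [if_congr h5 rfl rfl] at h2
  simp only [hm, h4, true_and] at h1
  rw [rowCount_sub, rowCount_sub]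
  have h6 : ∀ x : ZMod e, x = i - 1 ↔ x + 1 = i := fun x =>
    ⟨fun h => by linear_combination h, fun h => by linear_combination h⟩
  simp only [h6]
  have h7 : ∀ r : ℕ, (f r : ZMod e) - 1 - r + κ + 1 = (f r : ZMod e) - r + κ := fun r => by ring
  have h8 : ∀ r : ℕ, -1 - (r : ZMod e) + κ + 1 = -(r : ZMod e) + κ := fun r => by ring
  simp only [h7, h8]
  simp only [Finset.sum_sub_distrib] at h1 h2 ⊢
  linarith

/-- Pairs (bead, gap) lying on the same runner of the abacus, with the gap before the bead. -/
def gapPairs (e : ℕ) (X : Finset ℕ) : Finset ((_ : ℕ) × ℕ) :=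
  X.sigma fun b => (Finset.range b).filter fun x => x ∉ X ∧ (x : ZMod e) = b

theorem div_eq_card {e : ℕ} (he : 0 < e) (b : ℕ) :
    b / e = ((Finset.range b).filter fun x : ℕ => (x : ZMod e) = b).card := by
  have h := Nat.count_modEq_card b he b
  rw [Nat.count_eq_card_filter_range] at h
  simpa [ZMod.natCast_eq_natCast_iff] using h.symm

theorem card_residue_range {e : ℕ} [NeZero e] (N : ℕ) (κ j : ZMod e) :
    ((Finset.range (e * N)).filter fun x : ℕ => (x : ZMod e) + κ = j).card = N := by
  have he : 0 < e := NeZero.pos e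
  have h := Nat.count_modEq_card (e * N) he (j - κ).val
  rw [Nat.count_eq_card_filter_range] at h
  simp only [← ZMod.natCast_eq_natCast_iff, ZMod.natCast_val, ZMod.cast_id] at h
  simpa [he, eq_sub_iff_add_eq] using h

theorem two_mul_sum_div_s14 {e : ℕ} [NeZero e] (κ : ZMod e) (X : Finset ℕ) :
    2 * ∑ b ∈ X, ((b / e : ℕ) : ℤ) + X.card =
      ∑ j : ZMod e, ((X.filter fun b : ℕ => (b : ZMod e) + κ = j).card : ℤ) ^ 2 +
        2 * (gapPairs e X).card := by
  have h1 : ∑ j : ZMod e, ((X.filter fun b : ℕ => (b : ZMod e) + κ = j).card : ℤ) ^ 2 =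
      ∑ b ∈ X, ∑ x ∈ X, if (x : ZMod e) = b then 1 else 0 := by
    simp only [Finset.card_filter, sq]
    push_cast
    simp only [Finset.sum_mul_sum]
    rw [Finset.sum_comm]
    refine Finset.sum_congr rfl fun b _ => ?_
    rw [Finset.sum_comm]
    refine Finset.sum_congr rfl fun x _ => ?_
    simp [add_left_inj, eq_comm]
  have h2 : ∑ b ∈ X, ∑ x ∈ X, (if (x : ZMod e) = b then 1 else 0 : ℤ) =
      ∑ b ∈ X, ∑ x ∈ X, (if x < b ∧ (x : ZMod e) = b then 1 else 0 : ℤ) +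
      ∑ b ∈ X, ∑ x ∈ X, (if b < x ∧ (b : ZMod e) = x then 1 else 0 : ℤ) + X.card := by
    have hcard : (X.card : ℤ) = ∑ b ∈ X, ∑ x ∈ X, if b = x then 1 else 0 := by
      simp
    rw [hcard]
    simp only [← Finset.sum_add_distrib]
    refine Finset.sum_congr rfl fun b _ => ?_
    refine Finset.sum_congr rfl fun x _ => ?_
    rcases lt_trichotomy x b with h | rfl | h
    · simp [h, h.ne', h.not_gt]
    · simp
    · simp [h, h.ne, h.not_gt, eq_comm]
  have h3 : ∑ b ∈ X, ∑ x ∈ X, (if b < x ∧ (b : ZMod e) = x then 1 else 0 : ℤ) =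
      ∑ b ∈ X, ∑ x ∈ X, (if x < b ∧ (x : ZMod e) = b then 1 else 0 : ℤ) := Finset.sum_comm
  have h4 : ∑ b ∈ X, ((b / e : ℕ) : ℤ) =
      ∑ b ∈ X, ∑ x ∈ X, (if x < b ∧ (x : ZMod e) = b then 1 else 0 : ℤ) +
        (gapPairs e X).card := by
    unfold gapPairs
    rw [Finset.card_sigma, Nat.cast_sum, ← Finset.sum_add_distrib]
    refine Finset.sum_congr rfl fun b _ => ?_
    rw [div_eq_card (NeZero.pos e) b, ← Finset.card_filter_add_card_filter_not (fun x => x ∈ X)]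
    push_cast
    congr 1
    · rw [← Finset.sum_filter, Finset.sum_const, nsmul_one]
      norm_cast
      congr 1
      ext x
      simp
      tauto
    · norm_cast
      congr 1
      ext x
      simp
      tauto
  rw [h4, h1, h2, h3]
  ring

theorem beta_strictAnti {f : ℕ → ℕ} (hf : ∀ r, f (r + 1) ≤ f r) {k r s : ℕ} (hrs : r < s)
    (hs : s < k) : f s + (k - (s + 1)) < f r + (k - (r + 1)) := by
  have := antitone_nat_of_succ_le hf hrs.le
  omega

theorem beta_injOn {f : ℕ → ℕ} (hf : ∀ r, f (r + 1) ≤ f r) (k : ℕ) :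
    Set.InjOn (fun r => f r + (k - (r + 1))) (Finset.range k) := by
  intro r hr s hs h
  simp only [Finset.coe_range, Set.mem_Iio] at hr hs
  rcases lt_trichotomy r s with h' | h' | h'
  · exact absurd h (beta_strictAnti hf h' hs).ne'
  · exact h'
  · exact absurd h (beta_strictAnti hf h' hr).ne

theorem beta_cast {e k : ℕ} (hk : (k : ZMod e) = 0) (f : ℕ → ℕ) {r : ℕ} (hr : r < k) :
    ((f r + (k - (r + 1)) : ℕ) : ZMod e) = (f r : ZMod e) - 1 - r := by
  rw [Nat.cast_add, Nat.cast_sub (by omega), hk]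
  push_cast
  ring

theorem betaSet_zero (k : ℕ) : betaSet (fun _ => 0) k = Finset.range k := by
  ext x
  simp only [betaSet, Finset.mem_image, Finset.mem_range]
  exact ⟨by rintro ⟨r, hr, rfl⟩; omega, fun h => ⟨k - (x + 1), by omega, by omega⟩⟩

theorem card_residue_betaSet {e k : ℕ} (hk : (k : ZMod e) = 0) {f : ℕ → ℕ}
    (hf : ∀ r, f (r + 1) ≤ f r) (κ j : ZMod e) :
    (((betaSet f k).filter fun b : ℕ => (b : ZMod e) + κ = j).card : ℤ) =
      ∑ r ∈ Finset.range k, if (f r : ZMod e) - 1 - r + κ = j then 1 else 0 := by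
  rw [Finset.card_filter, betaSet, Finset.sum_image (beta_injOn hf k)]
  push_cast
  refine Finset.sum_congr rfl fun r hr => ?_
  have := beta_cast hk f (Finset.mem_range.1 hr)
  push_cast at this
  rw [this]

theorem rowCount_charge {e k : ℕ} (hk : (k : ZMod e) = 0) (κ : ZMod e) (f : ℕ → ℕ) :
    rowCount e κ f k κ = ∑ r ∈ Finset.range k,
      ((((f r + (k - (r + 1))) / e : ℕ) : ℤ) - (((k - (r + 1)) / e : ℕ) : ℤ)) := by
  unfold rowCount
  refine Finset.sum_congr rfl fun r hr => ?_
  have hr := Finset.mem_range.1 hr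
  generalize f r = n
  induction n with
  | zero => simp
  | succ n ih =>
    rw [Finset.sum_range_succ, ih, show n + 1 + (k - (r + 1)) = (n + (k - (r + 1))) + 1 by ring,
      Nat.succ_div]
    have : (n : ZMod e) - r + κ = κ ↔ e ∣ n + (k - (r + 1)) + 1 := by
      rw [← ZMod.natCast_eq_zero_iff, add_eq_right]
      have h := beta_cast hk (fun _ => n) hr
      rw [Nat.cast_succ, h]
      exact ⟨fun h => by linear_combination h, fun h => by linear_combination h⟩
    simp only [this]
    push_cast
    ring

theorem two_mul_rowCount_charge {e : ℕ} [NeZero e] (N : ℕ) (κ : ZMod e) {f : ℕ → ℕ}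
    (hf : ∀ r, f (r + 1) ≤ f r) :
    2 * rowCount e κ f (e * N) κ =
      ∑ j : ZMod e, (rowCount e κ f (e * N) j - rowCount e κ f (e * N) (j + 1)) ^ 2 +
        2 * (gapPairs e (betaSet f (e * N))).card := by
  have hk : ((e * N : ℕ) : ZMod e) = 0 := by simp
  have h0 : ∀ r : ℕ, (fun _ : ℕ => 0 : ℕ → ℕ) (r + 1) ≤ (fun _ : ℕ => 0 : ℕ → ℕ) r :=
    fun _ => le_rfl
  have hd : ∀ j : ZMod e, rowCount e κ f (e * N) j - rowCount e κ f (e * N) (j + 1) =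
      (((betaSet f (e * N)).filter fun b : ℕ => (b : ZMod e) + κ = j).card : ℤ) - N := by
    intro j
    have h := card_residue_betaSet (f := fun _ => 0) hk h0 κ j
    rw [betaSet_zero, card_residue_range] at h
    rw [rowCount_sub, card_residue_betaSet hk hf, Finset.sum_sub_distrib, h]
    simp
  have hcard : ∀ g : ℕ → ℕ, (∀ r, g (r + 1) ≤ g r) → (betaSet g (e * N)).card = e * N := by
    intro g hg
    rw [betaSet, Finset.card_image_of_injOn (beta_injOn hg _), Finset.card_range]
  have hsum : ∀ g : ℕ → ℕ, (∀ r, g (r + 1) ≤ g r) →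
      ∑ b ∈ betaSet g (e * N), ((b / e : ℕ) : ℤ) = ∑ r ∈ Finset.range (e * N),
        (((g r + (e * N - (r + 1))) / e : ℕ) : ℤ) := by
    intro g hg
    rw [betaSet, Finset.sum_image (beta_injOn hg _)]
  have hgap : gapPairs e (Finset.range (e * N)) = ∅ := by
    unfold gapPairs
    refine Finset.eq_empty_of_forall_notMem ?_
    rintro ⟨b, x⟩ h
    simp only [Finset.mem_sigma, Finset.mem_filter, Finset.mem_range] at h
    omega
  have h1 := two_mul_sum_div_s14 κ (betaSet f (e * N))
  have h2 := two_mul_sum_div_s14 κ (betaSet (fun _ => 0) (e * N))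
  rw [hcard _ hf, hsum _ hf] at h1
  rw [hcard (fun _ => 0) h0, hsum (fun _ => 0) h0, betaSet_zero, hgap] at h2
  simp only [card_residue_range] at h2
  rw [rowCount_charge hk, Finset.sum_sub_distrib]
  simp only [hd]
  have h3 : ∑ j : ZMod e,
      (((betaSet f (e * N)).filter fun b : ℕ => (b : ZMod e) + κ = j).card : ℤ) = e * N := by
    have := Finset.card_eq_sum_card_fiberwise (s := betaSet f (e * N))
      (f := fun b : ℕ => (b : ZMod e) + κ) (t := Finset.univ) (fun _ _ => Finset.mem_coe.2 (Finset.mem_univ _))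
    rw [hcard _ hf] at this
    exact_mod_cast this.symm
  simp only [sub_sq, Finset.sum_add_distrib, Finset.sum_sub_distrib, ← Finset.sum_mul,
    ← Finset.mul_sum, h3]
  simp only [Finset.sum_const, Finset.card_univ, ZMod.card, zero_add, nsmul_eq_mul,
    Finset.card_empty] at h2 ⊢
  push_cast at h1 h2 ⊢
  linarith

theorem card_remRows_mul_card_addRows_le {e k : ℕ} (he : 2 ≤ e) (hk : (k : ZMod e) = 0)
    (κ : ZMod e) {f : ℕ → ℕ} (hf : ∀ r, f (r + 1) ≤ f r) (i : ZMod e) :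
    (remRows e κ f k i).card * (addRows e κ f k i).card ≤
      (gapPairs e (betaSet f k)).card := by
  have : Fact (1 < e) := ⟨he⟩
  let B : ℕ → ℕ := fun r => f r + (k - (r + 1))
  have hB : ∀ r s, r < s → s < k → B s < B r := fun r s => beta_strictAnti hf
  have hmem : ∀ r, r < k → B r ∈ betaSet f k := fun r hr =>
    Finset.mem_image_of_mem _ (Finset.mem_range.2 hr)
  have hrem : ∀ r ∈ remRows e κ f k i,
      r < k ∧ 0 < B r ∧ B r - 1 ∉ betaSet f k ∧ (B r : ZMod e) + κ = i := by
    intro r hr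
    simp only [remRows, Finset.mem_filter, Finset.mem_range] at hr
    obtain ⟨hr, h1, h2⟩ := hr
    refine ⟨hr, by simp only [B]; omega, ?_, by simp only [B]; rw [beta_cast hk f hr, h2]⟩
    simp only [betaSet, Finset.mem_image, Finset.mem_range, not_exists, not_and]
    intro s hs h
    change B s = B r - 1 at h
    have hpos : 0 < B r := by simp only [B]; omega
    rcases lt_or_ge r s with h' | h'
    · have h3 : f s ≤ f (r + 1) := antitone_nat_of_succ_le hf h'
      simp only [B] at h
      omega
    · rcases h'.lt_or_eq with h' | rfl
      · have := hB s r h' hr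
        omega
      · omega
  have hadd : ∀ r ∈ addRows e κ f k i,
      r < k ∧ B r + 1 ∉ betaSet f k ∧ (B r : ZMod e) + 1 + κ = i := by
    intro r hr
    simp only [addRows, Finset.mem_filter, Finset.mem_range] at hr
    obtain ⟨hr, h1, h2⟩ := hr
    refine ⟨hr, ?_, by simp only [B]; rw [beta_cast hk f hr, ← h2]; ring⟩
    simp only [betaSet, Finset.mem_image, Finset.mem_range, not_exists, not_and]
    intro s hs h
    change B s = B r + 1 at h
    rcases lt_or_ge s r with h' | h'
    · have h3 : f (r - 1) ≤ f s := antitone_nat_of_succ_le hf (by omega)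
      simp only [B] at h
      omega
    · rcases h'.lt_or_eq with h' | rfl
      · have := hB r s h' hs
        omega
      · omega
  rw [← Finset.card_product]
  refine Finset.card_le_card_of_injOn
    (fun p => if B p.2 + 1 < B p.1 then ⟨B p.1, B p.2 + 1⟩ else ⟨B p.2, B p.1 - 1⟩) ?_ ?_
  · rintro ⟨ρ, α⟩ hp
    rw [Finset.mem_coe, Finset.mem_product] at hp
    obtain ⟨h1, h2⟩ := hp
    dsimp only at h1 h2
    obtain ⟨r1, r2, r3, r4⟩ := hrem _ h1
    obtain ⟨a1, a2, a3⟩ := hadd _ h2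
    have hne : B ρ ≠ B α + 1 := fun h => a2 (h ▸ hmem _ r1)
    simp only [gapPairs]
    split_ifs with h
    · simp only [Finset.coe_sigma, Set.mem_sigma_iff, Finset.mem_coe, Finset.mem_filter,
        Finset.mem_range]
      refine ⟨hmem _ r1, h, a2, ?_⟩
      push_cast
      linear_combination a3 - r4
    · simp only [Finset.coe_sigma, Set.mem_sigma_iff, Finset.mem_coe, Finset.mem_filter,
        Finset.mem_range]
      refine ⟨hmem _ a1, by omega, r3, ?_⟩
      rw [Nat.cast_sub r2]
      push_cast
      linear_combination r4 - a3
  · rintro ⟨ρ, α⟩ hp ⟨ρ', α'⟩ hp' heq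
    rw [Finset.mem_coe, Finset.mem_product] at hp hp'
    obtain ⟨h1, h2⟩ := hp
    obtain ⟨h1', h2'⟩ := hp'
    dsimp only at h1 h2 h1' h2'
    obtain ⟨r1, r2, r3, r4⟩ := hrem _ h1
    obtain ⟨a1, a2, a3⟩ := hadd _ h2
    obtain ⟨r1', r2', r3', r4'⟩ := hrem _ h1'
    obtain ⟨a1', a2', a3'⟩ := hadd _ h2'
    have hinj : ∀ r s, r < k → s < k → B r = B s → r = s := fun r s hr hs h =>
      beta_injOn hf k (by simpa using hr) (by simpa using hs) h
    have hres : ∀ ρ α, (B ρ : ZMod e) + κ = i → (B α : ZMod e) + 1 + κ = i → B ρ ≠ B α := by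
      intro ρ α h h' hn
      rw [hn] at h
      exact one_ne_zero (α := ZMod e) (by linear_combination h' - h)
    simp only at heq
    split_ifs at heq with h h' h' <;>
      simp only [Sigma.mk.injEq, heq_eq_eq] at heq
    · rw [hinj _ _ r1 r1' heq.1, hinj _ _ a1 a1' (by omega)]
    · exact absurd heq.1 (hres _ _ r4 a3')
    · exact absurd heq.1.symm (hres _ _ r4' a3)
    · rw [hinj _ _ a1 a1' heq.1, hinj _ _ r1 r1' (by omega)]

/-- The nodes of a bipartition of residue `j`, counted component by component. -/
theorem cnt_eq_s14 (e : ℕ) (κ : Fin 2 → ZMod e) {lam : Fin 2 → ℕ → ℕ} {k : ℕ}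
    (hk : ∀ a r, k ≤ r → lam a r = 0) (j : ZMod e) :
    (cnt e κ lam j : ℤ) =
      rowCount e (κ 0) (lam 0) k j + rowCount e (κ 1) (lam 1) k j := by
  let S : Finset Node := ((Finset.univ : Finset (Fin 2)).sigma fun a =>
    (Finset.range k).sigma fun r => (Finset.range (lam a r)).filter fun c : ℕ =>
      (c : ZMod e) - r + κ a = j).image fun p => (p.2.1, p.2.2, p.1)
  have hS : {x : Node | x ∈ Diagram lam ∧ res e κ x = j} = ↑S := by
    ext ⟨r, c, a⟩
    simp only [S, Diagram, res, Set.mem_ofPred_eq, Finset.coe_image, Set.mem_image, Finset.mem_coe,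
      Finset.mem_sigma, Finset.mem_filter, Finset.mem_range, Finset.mem_univ, true_and]
    constructor
    · rintro ⟨h1, h2⟩
      refine ⟨⟨a, r, c⟩, ⟨?_, h1, h2⟩, rfl⟩
      by_contra h
      have := hk a r (by simpa using h)
      omega
    · rintro ⟨⟨a', r', c'⟩, ⟨h1, h2, h3⟩, h⟩
      simp only [Prod.mk.injEq] at h
      obtain ⟨rfl, rfl, rfl⟩ := h
      exact ⟨h2, h3⟩
  rw [cnt, hS, Set.ncard_coe_finset, Finset.card_image_of_injective, Finset.card_sigma,
    Fin.sum_univ_two, Finset.card_sigma, Finset.card_sigma]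
  · simp only [rowCount, Finset.card_filter]
    push_cast
    rfl
  · rintro ⟨a, r, c⟩ ⟨a', r', c'⟩ h
    simp only [Prod.mk.injEq] at h
    obtain ⟨rfl, rfl, rfl⟩ := h
    rfl

theorem card_image_rows (lam : Fin 2 → ℕ → ℕ) (A : Fin 2 → Finset ℕ) (col : ℕ → ℕ) :
    (((Finset.univ : Finset (Fin 2)).sigma A).image
      fun p => ((p.2, col (lam p.1 p.2), p.1) : Node)).card = (A 0).card + (A 1).card := by
  rw [Finset.card_image_of_injective, Finset.card_sigma, Fin.sum_univ_two]
  rintro ⟨a, r⟩ ⟨a', r'⟩ h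
  simp only [Prod.mk.injEq] at h
  obtain ⟨rfl, -, rfl⟩ := h
  rfl

theorem setOf_isAddable_eq (e : ℕ) (κ : Fin 2 → ZMod e) {lam : Fin 2 → ℕ → ℕ}
    (hlam : IsBipartition lam) {k : ℕ} (hk : 0 < k) (hz : ∀ a r, k ≤ r + 1 → lam a r = 0)
    (i : ZMod e) :
    {x : Node | IsAddable lam x ∧ res e κ x = i} =
      ↑(((Finset.univ : Finset (Fin 2)).sigma fun a => addRows e (κ a) (lam a) k i).image
        fun p => ((p.2, id (lam p.1 p.2), p.1) : Node)) := by
  ext ⟨r, c, a⟩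
  simp only [isAddable_iff hlam, addRows, res, Set.mem_ofPred_eq, Finset.coe_image, Set.mem_image,
    Finset.mem_coe, Finset.mem_sigma, Finset.mem_filter, Finset.mem_range, Finset.mem_univ,
    true_and, id]
  constructor
  · rintro ⟨⟨rfl, h1⟩, h2⟩
    refine ⟨⟨a, r⟩, ⟨?_, h1, h2⟩, rfl⟩
    by_contra h
    simp only [not_lt] at h
    have := hz a (r - 1) (by omega)
    omega
  · rintro ⟨⟨a', r'⟩, ⟨h1, h2, h3⟩, h⟩
    simp only [Prod.mk.injEq] at h
    obtain ⟨rfl, rfl, rfl⟩ := h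
    exact ⟨⟨rfl, h2⟩, h3⟩

theorem remCount_le (e : ℕ) (κ : Fin 2 → ZMod e) {lam : Fin 2 → ℕ → ℕ}
    {k : ℕ} (hk : ∀ a r, k ≤ r → lam a r = 0) (i : ZMod e) :
    remCount e κ lam i ≤
      (remRows e (κ 0) (lam 0) k i).card + (remRows e (κ 1) (lam 1) k i).card := by
  rw [← card_image_rows lam (fun a => remRows e (κ a) (lam a) k i) (· - 1), remCount,
    ← Set.ncard_coe_finset]
  refine Set.ncard_le_ncard ?_ (Finset.finite_toSet _)
  rintro ⟨r, c, a⟩ ⟨h1, h2⟩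
  obtain ⟨h3, h4⟩ := isRemovable_imp h1
  simp only [remRows, res, Finset.coe_image, Set.mem_image,
    Finset.mem_coe, Finset.mem_sigma, Finset.mem_filter, Finset.mem_range, Finset.mem_univ,
    true_and] at h2 ⊢
  refine ⟨⟨a, r⟩, ⟨?_, h3, ?_⟩, by simp only [← h4, Nat.add_sub_cancel]⟩
  · by_contra h
    have := hk a r (by simpa using h)
    omega
  · rw [← h4, ← h2]
    push_cast
    ring

theorem exists_step_function {e : ℕ} (he : 2 ≤ e) (κ₁ κ₂ : ZMod e) :
    ∃ h : ZMod e → ℤ, (∀ j, h j ^ 2 = h j) ∧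
      ∀ j, h j - h (j - 1) = (if κ₁ = j then 1 else 0) - if κ₂ = j then 1 else 0 := by
  have : Fact (1 < e) := ⟨he⟩
  have : NeZero e := ⟨by omega⟩
  refine ⟨fun j => if (j - κ₁).val < (κ₂ - κ₁).val then 1 else 0, fun j => by
    dsimp only
    split_ifs <;> norm_num, fun j => ?_⟩
  have h1 : κ₁ = j ↔ j - κ₁ = 0 := by rw [sub_eq_zero, eq_comm]
  have h2 : κ₂ = j ↔ j - κ₁ = κ₂ - κ₁ := by rw [sub_left_inj, eq_comm]
  simp only [h1, h2, sub_right_comm j 1 κ₁, ← (ZMod.val_injective e).eq_iff]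
  generalize j - κ₁ = t
  generalize κ₂ - κ₁ = m
  have hm := ZMod.val_lt m
  have h0 : (0 : ZMod e).val = 0 := ZMod.val_zero
  rw [h0]
  by_cases ht : t = 0
  · subst ht
    have : (0 - 1 : ZMod e).val = e - 1 := by
      rw [zero_sub, ZMod.neg_val, ZMod.val_one, if_neg one_ne_zero]
    rw [this, h0]
    split_ifs <;> omega
  · have hv : 0 < t.val := by rwa [ZMod.val_pos]
    have : (t - 1).val = t.val - 1 := by
      rw [ZMod.val_sub (by rw [ZMod.val_one]; exact hv), ZMod.val_one]
    rw [this]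
    split_ifs <;> omega

theorem sum_mul_sub_shift {e : ℕ} [NeZero e] (h c : ZMod e → ℤ) :
    ∑ j, h j * (c j - c (j + 1)) = ∑ j, (h j - h (j - 1)) * c j := by
  have := Equiv.sum_comp (Equiv.addRight (1 : ZMod e)) fun j => h (j - 1) * c j
  simp only [Equiv.coe_addRight, add_sub_cancel_right] at this
  simp only [mul_sub, sub_mul, Finset.sum_sub_distrib, this]

/-- A lower bound for (twice) the weight of a bipartition in terms of the contents of its two
components. -/
theorem exists_weight_bound {e : ℕ} (he : 2 ≤ e) [NeZero e] (κ₁ κ₂ i : ZMod e)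
    (c₁ c₂ : ZMod e → ℤ) (w₁ w₂ t₁ t₂ : ℤ)
    (h₁ : ∑ j, (c₁ j - c₁ (j + 1)) ^ 2 + 2 * w₁ ≤ 2 * c₁ κ₁)
    (h₂ : ∑ j, (c₂ j - c₂ (j + 1)) ^ 2 + 2 * w₂ ≤ 2 * c₂ κ₂)
    (ht₁ : (c₁ i - c₁ (i + 1)) - (c₁ (i - 1) - c₁ (i - 1 + 1)) = t₁ + if κ₁ = i then 1 else 0)
    (ht₂ : (c₂ i - c₂ (i + 1)) - (c₂ (i - 1) - c₂ (i - 1 + 1)) = t₂ + if κ₂ = i then 1 else 0) :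
    ∃ x y : ℤ, x - y = t₁ - t₂ ∧ 4 * (w₁ + w₂) + x * (x + 1) + y * (y + 1) ≤
      2 * (c₁ κ₁ + c₂ κ₁ + (c₁ κ₂ + c₂ κ₂)) -
        ∑ j, ((c₁ j + c₂ j) - (c₁ (j + 1) + c₂ (j + 1))) ^ 2 := by
  have : Fact (1 < e) := ⟨he⟩
  obtain ⟨h, hsq, hstep⟩ := exists_step_function he κ₁ κ₂
  have habel : ∀ c : ZMod e → ℤ, ∑ j, h j * (c j - c (j + 1)) = c κ₁ - c κ₂ := by
    intro c
    rw [sum_mul_sub_shift]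
    simp [hstep, sub_mul]
  have hzero : ∀ c : ZMod e → ℤ, ∑ j, (c j - c (j + 1)) = 0 := by
    intro c
    have := sum_mul_sub_shift (fun _ => 1) c
    simpa using this
  let E : ZMod e → ℤ := fun j => (c₁ j - c₁ (j + 1)) - (c₂ j - c₂ (j + 1)) - h j
  refine ⟨E i, E (i - 1), by simp only [E]; linarith [hstep i], ?_⟩
  have hnn : ∀ z : ℤ, 0 ≤ z * (z + 1) := fun z => by
    rcases le_or_gt 0 z with hz | hz <;> nlinarith
  have hE : E i * (E i + 1) + E (i - 1) * (E (i - 1) + 1) ≤ ∑ j, E j * (E j + 1) := by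
    have hne : i ≠ i - 1 := fun h => one_ne_zero (α := ZMod e) (by linear_combination h)
    rw [← Finset.sum_pair (f := fun j => E j * (E j + 1)) hne]
    exact Finset.sum_le_sum_of_subset_of_nonneg (Finset.subset_univ _) fun j _ _ => hnn _
  have hexp : ∑ j, E j * (E j + 1) = 2 * ∑ j, (c₁ j - c₁ (j + 1)) ^ 2 +
      2 * ∑ j, (c₂ j - c₂ (j + 1)) ^ 2 -
      ∑ j, ((c₁ j + c₂ j) - (c₁ (j + 1) + c₂ (j + 1))) ^ 2 -
      2 * ∑ j, h j * (c₁ j - c₁ (j + 1)) + 2 * ∑ j, h j * (c₂ j - c₂ (j + 1)) +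
      ∑ j, (c₁ j - c₁ (j + 1)) - ∑ j, (c₂ j - c₂ (j + 1)) := by
    simp only [Finset.mul_sum, ← Finset.sum_add_distrib, ← Finset.sum_sub_distrib]
    refine Finset.sum_congr rfl fun j _ => ?_
    simp only [E]
    linear_combination hsq j
  rw [habel, habel, hzero, hzero] at hexp
  linarith

theorem weight_bound_contradiction {r₁ a₁ r₂ a₂ x y : ℤ} (hr₁ : 0 ≤ r₁) (ha₁ : 0 ≤ a₁)
    (hr₂ : 0 ≤ r₂) (ha₂ : 0 ≤ a₂) (hxy : x - y = (r₁ - a₁) - (r₂ - a₂))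
    (hw : 4 * (r₁ * a₁ + r₂ * a₂) + x * (x + 1) + y * (y + 1) ≤ 6)
    (hd : 3 ≤ r₁ + r₂ - (a₁ + a₂)) (ha : 1 ≤ a₁ + a₂) : False := by
  have hnn : ∀ z : ℤ, 0 ≤ z * (z + 1) := fun z => by
    rcases le_or_gt 0 z with hz | hz <;> nlinarith
  have h1 := hnn x
  have h2 := hnn y
  have h3 := mul_nonneg hr₁ ha₁
  have h4 := mul_nonneg hr₂ ha₂
  have hx1 : -3 ≤ x := by nlinarith
  have hx2 : x ≤ 2 := by nlinarith
  have hy1 : -3 ≤ y := by nlinarith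
  have hy2 : y ≤ 2 := by nlinarith
  have hmul : ∀ r a : ℤ, 0 ≤ r → 0 ≤ a → r = 0 ∨ a = 0 ∨ r + a - 1 ≤ r * a := by
    intro r a hr ha
    by_cases h : r = 0 ∨ a = 0
    · tauto
    · have : 1 ≤ r ∧ 1 ≤ a := by omega
      right
      right
      nlinarith [mul_nonneg (sub_nonneg.2 this.1) (sub_nonneg.2 this.2)]
  have h5 := hmul r₁ a₁ hr₁ ha₁
  have h6 := hmul r₂ a₂ hr₂ ha₂
  generalize r₁ * a₁ = p₁ at *
  generalize r₂ * a₂ = p₂ at *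
  interval_cases x <;> interval_cases y <;> omega

/-! The statement. -/

theorem stmt14 (e : ℕ) (he : 2 ≤ e) (κ : Fin 2 → ZMod e) (lam : Fin 2 → ℕ → ℕ)
    (hlam : IsBipartition lam) (hwt : wt e κ lam = 3) (i : ZMod e)
    (hdel : 3 ≤ delta e κ lam i) :
    ¬ ∃ x : Node, IsAddable lam x ∧ res e κ x = i := by
  rintro ⟨x, hx⟩
  have : NeZero e := ⟨by omega⟩
  obtain ⟨N₀, hN₀⟩ := (hlam 0).2
  obtain ⟨N₁, hN₁⟩ := (hlam 1).2
  obtain ⟨N, hN⟩ : ∃ N, N = N₀ + N₁ + 1 := ⟨_, rfl⟩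
  obtain ⟨m, hm⟩ : ∃ m, e * N = m + 1 := Nat.exists_eq_succ_of_ne_zero (by subst hN; simp; omega)
  have hmN : N ≤ m := by nlinarith
  have hz : ∀ a r, m ≤ r → lam a r = 0 := by
    intro a r hr
    fin_cases a
    · exact hN₀ r (by omega)
    · exact hN₁ r (by omega)
  have hk : ((m + 1 : ℕ) : ZMod e) = 0 := by rw [← hm]; simp
  have hcnt := cnt_eq_s14 e κ (k := m + 1) fun a r hr => hz a r (by omega)
  have hbound : ∀ a : Fin 2,
      ∑ j, (rowCount e (κ a) (lam a) (m + 1) j - rowCount e (κ a) (lam a) (m + 1) (j + 1)) ^ 2 +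
        2 * (((remRows e (κ a) (lam a) (m + 1) i).card : ℤ) *
          (addRows e (κ a) (lam a) (m + 1) i).card) ≤
      2 * rowCount e (κ a) (lam a) (m + 1) (κ a) := by
    intro a
    have h1 := two_mul_rowCount_charge N (κ a) (hlam a).1
    have h2 := card_remRows_mul_card_addRows_le he hk (κ a) (hlam a).1 i
    rw [hm] at h1
    rw [h1]
    gcongr
    exact_mod_cast h2
  obtain ⟨x', y', hxy, hle⟩ := exists_weight_bound he (κ 0) (κ 1) i _ _ _ _ _ _
    (hbound 0) (hbound 1)
    (rowCount_second_difference (κ 0) (hlam 0).1 (hz 0 m le_rfl) i)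
    (rowCount_second_difference (κ 1) (hlam 1).1 (hz 1 m le_rfl) i)
  have hset := setOf_isAddable_eq e κ hlam m.succ_pos (fun a r hr => hz a r (by omega)) i
  have hadd : addCount e κ lam i = (addRows e (κ 0) (lam 0) (m + 1) i).card +
      (addRows e (κ 1) (lam 1) (m + 1) i).card := by
    rw [addCount, hset, Set.ncard_coe_finset]
    exact card_image_rows lam (fun a => addRows e (κ a) (lam a) (m + 1) i) id
  have hrem := remCount_le e κ (k := m + 1) (fun a r hr => hz a r (by omega)) i
  have hpos : 0 < addCount e κ lam i := by
    refine (Set.ncard_pos ?_).2 ⟨x, hx⟩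
    rw [hset]
    exact Finset.finite_toSet _
  have hwt' : 2 * ((cnt e κ lam (κ 0) : ℤ) + cnt e κ lam (κ 1)) -
      ∑ j : ZMod e, ((cnt e κ lam j : ℤ) - cnt e κ lam (j + 1)) ^ 2 = 6 := by
    have hsum : ∑ j : ZMod e, ((cnt e κ lam j : ℚ) - cnt e κ lam (j + 1)) ^ 2 =
        ∑ j ∈ Finset.range e,
          ((cnt e κ lam (j : ZMod e) : ℚ) - (cnt e κ lam ((j : ZMod e) + 1) : ℚ)) ^ 2 :=
      Finset.sum_nbij' ZMod.val (fun j : ℕ => (j : ZMod e))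
        (fun j _ => Finset.mem_range.2 (ZMod.val_lt j)) (fun _ _ => Finset.mem_univ _)
        (fun j _ => by simp) (fun j hj => ZMod.val_cast_of_lt (Finset.mem_range.1 hj))
        (fun j _ => by simp)
    rw [wt, ← hsum] at hwt
    have : (2 * ((cnt e κ lam (κ 0) : ℚ) + cnt e κ lam (κ 1)) -
      ∑ j : ZMod e, ((cnt e κ lam j : ℚ) - cnt e κ lam (j + 1)) ^ 2) = 6 := by linarith
    exact_mod_cast this
  simp only [hcnt] at hwt'
  rw [hwt'] at hle
  rw [delta] at hdel
  refine weight_bound_contradiction (by positivity) (by positivity) (by positivity)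
    (by positivity) hxy hle ?_ ?_ <;> omega

end Wt3
end
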